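/- Let R > 1, let t, t' be R-summable sequences of complex numbers, let σ : ℤ' → [0,1] satisfy Σ_{k∈ℤ', k<0} σ(k) < ∞, and let n ∈ ℤ. Assume the family (|s_λ(t) s_λ(t')|)_λ, indexed by all Young diagrams λ, is summable. Then Z_{t,t'} · D_n(t,t';σ) = Σ_λ s_λ(t) s_λ(t') ∏_{x ∈ S_0(λ)} (1 − σ(x − n)), the sum being over all Young diagrams λ; that is, the Fredholm determinant τ_n(t,t';σ) equals Z_{t,t'} times the expectation, under the Schur measure λ ↦ Z_{t,t'}^{−1} s_λ(t) s_λ(t'), of the multiplicative functional λ ↦ ∏_{x ∈ S_0(λ)} (1 − σ(x − n)). -/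

import Mathlib

open scoped BigOperators

noncomputable section

/-- `t : ℕ → ℂ` encodes the sequence `(t_1, t_2, …)` via `t n = t_{n+1}`.
`t` is `R`-summable if `∑_{n ≥ 1} |t_n| R^n < ∞`. -/
def RSummable (R : ℝ) (t : ℕ → ℂ) : Prop :=
  Summable fun n : ℕ => ‖t n‖ * R ^ (n + 1)

/-- `γ(z,t) = exp (∑_{n ≥ 1} t_n z^n)`. -/
def gammaFn (z : ℂ) (t : ℕ → ℂ) : ℂ :=
  Complex.exp (∑' n : ℕ, t n * z ^ (n + 1))

/-- `J(z;t,t') = exp (∑_{n ≥ 1} (t_n z^n − t'_n z^{-n}))`. -/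
def Jfun (z : ℂ) (t t' : ℕ → ℂ) : ℂ :=
  Complex.exp (∑' n : ℕ, (t n * z ^ (n + 1) - t' n * z⁻¹ ^ (n + 1)))

/-- `J_k(t,t')`, the `k`-th Laurent coefficient of `z ↦ J(z;t,t')`:
`J_k(t,t') = (1/(2π)) ∫ ₀^{2π} J(e^{iθ};t,t') e^{-ikθ} dθ`. -/
def Jcoef (t t' : ℕ → ℂ) (k : ℤ) : ℂ :=
  (2 * Real.pi : ℂ)⁻¹ *
    ∫ θ in (0:ℝ)..(2 * Real.pi),
      Jfun (Complex.exp (θ * Complex.I)) t t' * Complex.exp (-(k : ℂ) * θ * Complex.I)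

/-- The half-integer `a + 1/2 ∈ ℤ'` is encoded by the integer `a : ℤ`.
The kernel `K_{t,t',σ}(x,y) = ∑_{k ∈ ℤ'} σ(k) J_{x+k}(t,t') J_{-y-k}(-t,-t')`:
for `x = a + 1/2`, `y = b + 1/2`, `k = c + 1/2` one has `x + k = a + c + 1` and
`-y - k = -(b + c + 1)`. -/
def Kker (t t' : ℕ → ℂ) (σ : ℤ → ℝ) (a b : ℤ) : ℂ :=
  ∑' c : ℤ, (σ c : ℂ) * Jcoef t t' (a + c + 1) * Jcoef (-t) (-t') (-(b + c + 1))

/-- The indicator `1_{ℤ'_{>0}}` of the positive half-integers: `c + 1/2 > 0 ↔ 0 ≤ c`. -/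
def posInd : ℤ → ℝ := fun c => if 0 ≤ c then 1 else 0

/-- `Z_{t,t'} = exp (∑_{n ≥ 1} n t_n t'_n)`. -/
def Zconst (t t' : ℕ → ℂ) : ℂ :=
  Complex.exp (∑' n : ℕ, (n + 1 : ℂ) * t n * t' n)

/-- The Fredholm series `D_n` of a kernel `K` on `ℓ²(ℤ' ∩ (n,∞))`; the half-integer
`a + 1/2` belongs to `(n,∞)` iff `n ≤ a`. -/
def fredholmSeries (K : ℤ → ℤ → ℂ) (n : ℤ) : ℂ :=
  ∑' m : ℕ, ((-1 : ℂ) ^ m / m.factorial) *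
    ∑' x : Fin m → {a : ℤ // n ≤ a},
      Matrix.det (Matrix.of fun i j : Fin m => K (x i) (x j))

/-- Absolute convergence of the Fredholm series of `K` on `ℓ²(ℤ' ∩ (n,∞))`. -/
def FredholmAbsConv (K : ℤ → ℤ → ℂ) (n : ℤ) : Prop :=
  (∀ m : ℕ, Summable fun x : Fin m → {a : ℤ // n ≤ a} =>
      ‖Matrix.det (Matrix.of fun i j : Fin m => K (x i) (x j))‖) ∧
    Summable fun m : ℕ => (m.factorial : ℝ)⁻¹ *
      ∑' x : Fin m → {a : ℤ // n ≤ a},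
        ‖Matrix.det (Matrix.of fun i j : Fin m => K (x i) (x j))‖

/-- `τ_n(t,t';σ) = Z_{t,t'} · D_n(t,t';σ)`. -/
def tauFn (σ : ℤ → ℝ) (t t' : ℕ → ℂ) (n : ℤ) : ℂ :=
  Zconst t t' * fredholmSeries (Kker t t' σ) n

/-- `{z} = (z, z²/2, z³/3, …)`. -/
def chargeSeq (z : ℂ) : ℕ → ℂ := fun n => z ^ (n + 1) / (n + 1)

/-- `h_k(t)`: the Taylor coefficients of `γ(·,t)`, with `h_k(t) = 0` for `k < 0`. -/
def hcoef (t : ℕ → ℂ) (k : ℤ) : ℂ :=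
  if k < 0 then 0 else
    (2 * Real.pi : ℂ)⁻¹ *
      ∫ θ in (0:ℝ)..(2 * Real.pi),
        gammaFn (Complex.exp (θ * Complex.I)) t * Complex.exp (-(k : ℂ) * θ * Complex.I)

/-- Young diagrams (partitions): `part i` is the `(i+1)`-st part `λ_{i+1}`. -/
structure Partition' where
  part : ℕ → ℕ
  antitone : Antitone part
  ev_zero : ∃ N, ∀ i ≥ N, part i = 0

/-- The number `ℓ(λ)` of nonzero parts. -/
def Partition'.len (lam : Partition') : ℕ := sInf {N | lam.part N = 0}

/-- `s_λ(t) = det (h_{λ_i − i + j}(t))_{i,j = 1}^{ℓ(λ)}` (Jacobi–Trudi). -/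
def schurPoly (t : ℕ → ℂ) (lam : Partition') : ℂ :=
  Matrix.det (Matrix.of fun i j : Fin lam.len =>
    hcoef t ((lam.part i : ℤ) + (j : ℤ) - (i : ℤ)))

/-- `S_0(λ) = {λ_i − i + 1/2 : i ≥ 1} ⊂ ℤ'` in integer coordinates
(`a : ℤ` encodes the half-integer `a + 1/2`). -/
def S0 (lam : Partition') : Set ℤ := {a : ℤ | ∃ i : ℕ, a = (lam.part i : ℤ) - (i + 1)}

/-- The multiplicative functional `∏_{x ∈ S_0(λ)} (1 − σ(x − n))
  = ∏_{i ≥ 1} (1 − σ(λ_i − i + 1/2 − n))`. -/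
def multFunc (σ : ℤ → ℝ) (n : ℤ) (lam : Partition') : ℝ :=
  ∏' i : ℕ, (1 - σ ((lam.part i : ℤ) - (i + 1) - n))

section SchurExpectation

open Filter Topology
open scoped ENNReal

/-- The product of two infinite matrices. -/
def infMul {ι κ μ : Type} (A : ι → κ → ℂ) (B : κ → μ → ℂ) : ι → μ → ℂ :=
  fun i k => ∑' j, A i j * B j k

/-- Infinite matrices with uniformly bounded absolute row and column sums. -/
def IsSchur {ι κ : Type} (A : ι → κ → ℂ) : Prop :=
  ∃ M : ℝ≥0∞, M ≠ ⊤ ∧ (∀ i, ∑' j, ‖A i j‖ₑ ≤ M) ∧ ∀ j, ∑' i, ‖A i j‖ₑ ≤ M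

/-- Infinite matrices with absolutely summable entries. -/
def IsEntrySummable {ι κ : Type} (A : ι → κ → ℂ) : Prop :=
  ∑' i, ∑' j, ‖A i j‖ₑ ≠ ⊤

section InfMul

variable {ι κ μ ν : Type}

theorem summable_of_tsum_enorm_ne_top {f : ι → ℂ} (h : ∑' i, ‖f i‖ₑ ≠ ⊤) : Summable f :=
  (tsum_enorm_ne_top_iff_summable_norm.1 h).of_norm

theorem IsEntrySummable.isSchur {A : ι → κ → ℂ} (hA : IsEntrySummable A) : IsSchur A := by
  refine ⟨_, hA, fun i => ENNReal.le_tsum i, fun j => ?_⟩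
  exact ENNReal.tsum_le_tsum fun i => ENNReal.le_tsum j

theorem enorm_infMul_le (A : ι → κ → ℂ) (B : κ → μ → ℂ) (i : ι) (k : μ) :
    ‖infMul A B i k‖ₑ ≤ ∑' j, ‖A i j‖ₑ * ‖B j k‖ₑ := by
  refine enorm_tsum_le_tsum_enorm.trans_eq ?_
  simp [enorm_mul]

theorem tsum_enorm_mul_le {A : ι → κ → ℂ} {B : κ → μ → ℂ} {M N : ℝ≥0∞}
    (hA : ∀ i, ∑' j, ‖A i j‖ₑ ≤ M) (hB : ∀ j, ∑' k, ‖B j k‖ₑ ≤ N) (i : ι) :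
    ∑' k, ∑' j, ‖A i j‖ₑ * ‖B j k‖ₑ ≤ M * N := by
  rw [ENNReal.tsum_comm]
  calc ∑' j, ∑' k, ‖A i j‖ₑ * ‖B j k‖ₑ = ∑' j, ‖A i j‖ₑ * ∑' k, ‖B j k‖ₑ := by
        simp_rw [ENNReal.tsum_mul_left]
    _ ≤ ∑' j, ‖A i j‖ₑ * N := ENNReal.tsum_le_tsum fun j => by gcongr; exact hB j
    _ ≤ M * N := by rw [ENNReal.tsum_mul_right]; gcongr; exact hA i

theorem IsSchur.tsum_enorm_mul_ne_top {A : ι → κ → ℂ} {B : κ → μ → ℂ} (hA : IsSchur A)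
    (hB : IsSchur B) (i : ι) (k : μ) : ∑' j, ‖A i j‖ₑ * ‖B j k‖ₑ ≠ ⊤ := by
  obtain ⟨M, hM, hA, -⟩ := hA
  obtain ⟨N, hN, hB, -⟩ := hB
  refine ne_top_of_le_ne_top (ENNReal.mul_ne_top hM hN) ?_
  exact (ENNReal.le_tsum (f := fun k => ∑' j, ‖A i j‖ₑ * ‖B j k‖ₑ) k).trans
    (tsum_enorm_mul_le hA hB i)

theorem IsSchur.summable_mul {A : ι → κ → ℂ} {B : κ → μ → ℂ} (hA : IsSchur A)
    (hB : IsSchur B) (i : ι) (k : μ) : Summable fun j => A i j * B j k :=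
  summable_of_tsum_enorm_ne_top <| by simpa [enorm_mul] using hA.tsum_enorm_mul_ne_top hB i k

theorem IsSchur.infMul {A : ι → κ → ℂ} {B : κ → μ → ℂ} (hA : IsSchur A) (hB : IsSchur B) :
    IsSchur (infMul A B) := by
  obtain ⟨M, hM, hA, hA'⟩ := hA
  obtain ⟨N, hN, hB, hB'⟩ := hB
  refine ⟨M * N, ENNReal.mul_ne_top hM hN, fun i => ?_, fun k => ?_⟩
  · exact (ENNReal.tsum_le_tsum fun k => enorm_infMul_le A B i k).trans (tsum_enorm_mul_le hA hB i)
  · refine (ENNReal.tsum_le_tsum fun i => enorm_infMul_le A B i k).trans ?_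
    have := tsum_enorm_mul_le (A := fun k j => B j k) (B := fun j i => A i j) hB' hA' k
    simpa [mul_comm] using this

theorem IsEntrySummable.infMul_right {A : ι → κ → ℂ} {B : κ → μ → ℂ} (hA : IsEntrySummable A)
    (hB : IsSchur B) : IsEntrySummable (infMul A B) := by
  obtain ⟨N, hN, hB, -⟩ := hB
  refine ne_top_of_le_ne_top (ENNReal.mul_ne_top hA hN) ?_
  rw [← ENNReal.tsum_mul_right]
  refine ENNReal.tsum_le_tsum fun i => ?_
  refine (ENNReal.tsum_le_tsum fun k => enorm_infMul_le A B i k).trans ?_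
  exact tsum_enorm_mul_le (A := fun _ : Unit => A i) (fun _ => le_rfl) hB ()

theorem IsEntrySummable.transpose {A : ι → κ → ℂ} (hA : IsEntrySummable A) :
    IsEntrySummable fun j i => A i j := by
  rw [IsEntrySummable, ENNReal.tsum_comm]; exact hA

theorem IsSchur.transpose {A : ι → κ → ℂ} (hA : IsSchur A) : IsSchur fun j i => A i j := by
  obtain ⟨M, hM, h, h'⟩ := hA
  exact ⟨M, hM, h', h⟩

theorem infMul_transpose (A : ι → κ → ℂ) (B : κ → μ → ℂ) :
    (fun k i => infMul A B i k) = infMul (fun k j => B j k) (fun j i => A i j) := by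
  ext k i; simp [infMul, mul_comm]

theorem IsEntrySummable.infMul_left {A : ι → κ → ℂ} {B : κ → μ → ℂ} (hA : IsSchur A)
    (hB : IsEntrySummable B) : IsEntrySummable (infMul A B) := by
  have := (hB.transpose.infMul_right hA.transpose).transpose
  rwa [← infMul_transpose] at this

theorem infMul_assoc {A : ι → κ → ℂ} {B : κ → μ → ℂ} {C : μ → ν → ℂ} (hA : IsSchur A)
    (hB : IsSchur B) (hC : IsSchur C) : infMul (infMul A B) C = infMul A (infMul B C) := by
  ext i l
  simp only [infMul, ← tsum_mul_left, ← tsum_mul_right]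
  rw [Summable.tsum_comm]
  · simp only [mul_assoc]
  · apply summable_of_tsum_enorm_ne_top
    obtain ⟨M, hM, hA, -⟩ := hA
    obtain ⟨N, hN, hB, -⟩ := hB
    obtain ⟨P, hP, -, hC⟩ := hC
    refine ne_top_of_le_ne_top (ENNReal.mul_ne_top (ENNReal.mul_ne_top hM hN) hP) ?_
    have hle : ∀ k, ‖C k l‖ₑ ≤ P := fun k => (ENNReal.le_tsum k).trans (hC l)
    rw [ENNReal.tsum_prod', ENNReal.tsum_comm]
    dsimp only [Function.uncurry]
    calc ∑' k, ∑' j, ‖A i j * B j k * C k l‖ₑ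
        ≤ ∑' k, ∑' j, ‖A i j‖ₑ * ‖B j k‖ₑ * P := by
          refine ENNReal.tsum_le_tsum fun k => ENNReal.tsum_le_tsum fun j => ?_
          rw [enorm_mul, enorm_mul]; gcongr; exact hle k
      _ = (∑' k, ∑' j, ‖A i j‖ₑ * ‖B j k‖ₑ) * P := by simp_rw [ENNReal.tsum_mul_right]
      _ ≤ M * N * P := by gcongr; exact tsum_enorm_mul_le hA hB i

theorem IsSchur.add {A B : ι → κ → ℂ} (hA : IsSchur A) (hB : IsSchur B) : IsSchur (A + B) := by
  obtain ⟨M, hM, hA, hA'⟩ := hA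
  obtain ⟨N, hN, hB, hB'⟩ := hB
  refine ⟨M + N, ENNReal.add_ne_top.2 ⟨hM, hN⟩, fun i => ?_, fun j => ?_⟩
  · refine (ENNReal.tsum_le_tsum fun j => enorm_add_le (A i j) (B i j)).trans ?_
    rw [ENNReal.tsum_add]; gcongr; exacts [hA i, hB i]
  · refine (ENNReal.tsum_le_tsum fun i => enorm_add_le (A i j) (B i j)).trans ?_
    rw [ENNReal.tsum_add]; gcongr; exacts [hA' j, hB' j]

theorem IsSchur.neg {A : ι → κ → ℂ} (hA : IsSchur A) : IsSchur (-A) := by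
  simpa [IsSchur] using hA

theorem IsEntrySummable.add {A B : ι → κ → ℂ} (hA : IsEntrySummable A)
    (hB : IsEntrySummable B) : IsEntrySummable (A + B) := by
  refine ne_top_of_le_ne_top (ENNReal.add_ne_top.2 ⟨hA, hB⟩) ?_
  rw [← ENNReal.tsum_add]
  refine ENNReal.tsum_le_tsum fun i => ?_
  rw [← ENNReal.tsum_add]
  exact ENNReal.tsum_le_tsum fun j => enorm_add_le (A i j) (B i j)

theorem IsEntrySummable.neg {A : ι → κ → ℂ} (hA : IsEntrySummable A) : IsEntrySummable (-A) := by
  simpa [IsEntrySummable] using hA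

theorem infMul_add {A : ι → κ → ℂ} {B C : κ → μ → ℂ} (hA : IsSchur A)
    (hB : IsSchur B) (hC : IsSchur C) : infMul A (B + C) = infMul A B + infMul A C := by
  ext i k
  simp only [infMul, Pi.add_apply, mul_add]
  exact (hA.summable_mul hB i k).tsum_add (hA.summable_mul hC i k)

theorem add_infMul {A B : ι → κ → ℂ} {C : κ → μ → ℂ} (hA : IsSchur A)
    (hB : IsSchur B) (hC : IsSchur C) : infMul (A + B) C = infMul A C + infMul B C := by
  ext i k
  simp only [infMul, Pi.add_apply, add_mul]
  exact (hA.summable_mul hC i k).tsum_add (hB.summable_mul hC i k)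

theorem IsSchur.diagonal (w : ι → ℂ) (hw : ∀ i, ‖w i‖ ≤ 1) [DecidableEq ι] :
    IsSchur fun i j : ι => if i = j then w i else 0 := by
  have h : ∀ i, ‖w i‖ₑ ≤ 1 := fun i => by
    rw [← ofReal_norm]; exact ENNReal.ofReal_le_one.2 (hw i)
  refine ⟨1, ENNReal.one_ne_top, fun i => ?_, fun j => ?_⟩
  · rw [tsum_eq_single i]
    · simpa using h i
    · intro j hj; simp [hj.symm]
  · rw [tsum_eq_single j]
    · simpa using h j
    · intro i hi; simp [hi]

end InfMul

/-- The ring of infinite matrices with bounded absolute row and column sums. -/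
def schurRing : AddSubgroup (ℕ → ℕ → ℂ) where
  carrier := {A | IsSchur A}
  add_mem' := IsSchur.add
  zero_mem' := ⟨0, ENNReal.zero_ne_top, by simp, by simp⟩
  neg_mem' := IsSchur.neg

instance : Mul schurRing := ⟨fun A B => ⟨infMul A.1 B.1, A.2.infMul B.2⟩⟩

instance : One schurRing :=
  ⟨⟨fun i j => if i = j then 1 else 0, IsSchur.diagonal (fun _ => 1) (by simp)⟩⟩

theorem schurRing_coe_mul (A B : schurRing) : (A * B).1 = infMul A.1 B.1 := rfl

theorem schurRing_coe_one : (1 : schurRing).1 = fun i j => if i = j then 1 else 0 := rfl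

instance : Ring schurRing :=
  { (inferInstance : AddCommGroup schurRing), (inferInstance : Mul schurRing),
    (inferInstance : One schurRing) with
    mul_assoc := fun A B C => Subtype.ext (infMul_assoc A.2 B.2 C.2)
    left_distrib := fun A B C => Subtype.ext (infMul_add A.2 B.2 C.2)
    right_distrib := fun A B C => Subtype.ext (add_infMul A.2 B.2 C.2)
    one_mul := fun A => Subtype.ext <| by ext i k; simp [schurRing_coe_mul, schurRing_coe_one, infMul]
    mul_one := fun A => Subtype.ext <| by ext i k; simp [schurRing_coe_mul, schurRing_coe_one, infMul]
    zero_mul := fun A => Subtype.ext <| by ext i k; simp [schurRing_coe_mul, infMul]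
    mul_zero := fun A => Subtype.ext <| by ext i k; simp [schurRing_coe_mul, infMul] }

theorem Matrix.det_one_add_eq_sum_principal_minors {n R : Type*} [Fintype n] [DecidableEq n]
    [CommRing R] (M : Matrix n n R) :
    (1 + M).det = ∑ s : Finset n, (M.submatrix (Subtype.val : s → n) (Subtype.val : s → n)).det := by
  rw [add_comm]
  change Matrix.detRowAlternating ((fun i => M i) + fun i => (1 : Matrix n n R) i) = _
  rw [AlternatingMap.map_add_univ]
  exact Finset.sum_congr rfl fun s _ => Matrix.det_piecewise_one_eq_submatrix_det M s

/-- The Fredholm determinant of `1 + K`, as the sum of all finite principal minors of `K`. -/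
def fredDet (K : ℕ → ℕ → ℂ) : ℂ :=
  ∑' s : Finset ℕ, (Matrix.of fun i j : s => K i j).det

/-- Entrywise convergence of infinite matrices, with entries dominated by those of `W`. -/
structure DomTendsto {ι κ : Type} (A : ℕ → ι → κ → ℂ) (B W : ι → κ → ℂ) : Prop where
  tendsto : ∀ i j, Tendsto (fun n => A n i j) atTop (𝓝 (B i j))
  bound : ∀ n i j, ‖A n i j‖ ≤ ‖W i j‖

/-- The matrix of absolute values of the entries. -/
def normMatrix {ι κ : Type} (A : ι → κ → ℂ) : ι → κ → ℂ := fun i j => (‖A i j‖ : ℂ)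

section Basic

variable {ι κ μ : Type}

theorem enorm_normMatrix (A : ι → κ → ℂ) (i : ι) (j : κ) : ‖normMatrix A i j‖ₑ = ‖A i j‖ₑ := by
  rw [normMatrix, ← ofReal_norm, ← ofReal_norm]; simp

theorem IsSchur.normMatrix {A : ι → κ → ℂ} (hA : IsSchur A) : IsSchur (normMatrix A) := by
  simpa [IsSchur, enorm_normMatrix] using hA

theorem IsEntrySummable.normMatrix {A : ι → κ → ℂ} (hA : IsEntrySummable A) :
    IsEntrySummable (normMatrix A) := by
  simpa [IsEntrySummable, enorm_normMatrix] using hA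

theorem IsEntrySummable.mono {A B : ι → κ → ℂ} (hB : IsEntrySummable B)
    (h : ∀ i j, ‖A i j‖ ≤ ‖B i j‖) : IsEntrySummable A := by
  refine ne_top_of_le_ne_top hB ?_
  refine ENNReal.tsum_le_tsum fun i => ENNReal.tsum_le_tsum fun j => ?_
  exact enorm_le_iff_norm_le.2 (h i j)

theorem IsSchur.summable_norm_mul {A : ι → κ → ℂ} {B : κ → μ → ℂ} (hA : IsSchur A)
    (hB : IsSchur B) (i : ι) (k : μ) : Summable fun j => ‖A i j‖ * ‖B j k‖ := by
  simpa using (hA.summable_mul hB i k).norm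

theorem norm_infMul_le {A V : ι → κ → ℂ} {B W : κ → μ → ℂ} (hV : IsSchur V) (hW : IsSchur W)
    (hAV : ∀ i j, ‖A i j‖ ≤ ‖V i j‖) (hBW : ∀ i j, ‖B i j‖ ≤ ‖W i j‖) (i : ι) (k : μ) :
    ‖infMul A B i k‖ ≤ ‖infMul (normMatrix V) (normMatrix W) i k‖ := by
  have h : infMul (normMatrix V) (normMatrix W) i k = ((∑' j, ‖V i j‖ * ‖W j k‖ : ℝ) : ℂ) := by
    simp [infMul, normMatrix, Complex.ofReal_tsum]
  rw [h, Complex.norm_real, Real.norm_of_nonneg (tsum_nonneg fun j => by positivity)]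
  refine tsum_of_norm_bounded (hV.summable_norm_mul hW i k).hasSum fun j => ?_
  rw [norm_mul]
  gcongr
  exacts [hAV i j, hBW j k]

theorem DomTendsto.infMul {A : ℕ → ι → κ → ℂ} {A' V : ι → κ → ℂ} {B : ℕ → κ → μ → ℂ}
    {B' W : κ → μ → ℂ} (hA : DomTendsto A A' V) (hB : DomTendsto B B' W) (hV : IsSchur V)
    (hW : IsSchur W) :
    DomTendsto (fun n => infMul (A n) (B n)) (infMul A' B')
      (infMul (normMatrix V) (normMatrix W)) where
  tendsto i k := by
    refine tendsto_tsum_of_dominated_convergence (hV.summable_norm_mul hW i k)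
      (fun j => (hA.tendsto i j).mul (hB.tendsto j k)) (Eventually.of_forall fun n j => ?_)
    rw [norm_mul]
    gcongr
    exacts [hA.bound n i j, hB.bound n j k]
  bound n i k := norm_infMul_le hV hW (hA.bound n) (hB.bound n) i k

theorem DomTendsto.add {A B : ℕ → ι → κ → ℂ} {A' B' V W : ι → κ → ℂ}
    (hA : DomTendsto A A' V) (hB : DomTendsto B B' W) :
    DomTendsto (fun n => A n + B n) (A' + B') (normMatrix V + normMatrix W) where
  tendsto i j := (hA.tendsto i j).add (hB.tendsto i j)
  bound n i j := by
    have h : (normMatrix V + normMatrix W) i j = ((‖V i j‖ + ‖W i j‖ : ℝ) : ℂ) := by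
      simp [normMatrix]
    rw [h, Complex.norm_real, Real.norm_of_nonneg (by positivity)]
    exact (norm_add_le _ _).trans (add_le_add (hA.bound n i j) (hB.bound n i j))

end Basic

theorem norm_det_le_prod_sum {n : Type*} [Fintype n] [DecidableEq n] (M : Matrix n n ℂ) :
    ‖M.det‖ ≤ ∏ i, ∑ j, ‖M i j‖ := by
  rw [Finset.prod_univ_sum, Fintype.piFinset_univ, ← Matrix.det_transpose, Matrix.det_apply]
  refine (norm_sum_le _ _).trans ?_
  calc ∑ π : Equiv.Perm n, ‖Equiv.Perm.sign π • ∏ i, M.transpose (π i) i‖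
      = ∑ π : Equiv.Perm n, ∏ i, ‖M i (π i)‖ := by
        refine Finset.sum_congr rfl fun π _ => ?_
        rw [Units.smul_def, zsmul_eq_mul, norm_mul, norm_prod]
        rcases Int.units_eq_one_or (Equiv.Perm.sign π) with h | h <;> simp [h]
    _ = ∑ g ∈ Finset.univ.map ⟨fun π : Equiv.Perm n => (π : n → n), DFunLike.coe_injective⟩,
          ∏ i, ‖M i (g i)‖ := by simp
    _ ≤ _ := Finset.sum_le_sum_of_subset_of_nonneg (Finset.subset_univ _)
        fun _ _ _ => Finset.prod_nonneg fun _ _ => norm_nonneg _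

theorem IsEntrySummable.summable_row {ι κ : Type} {W : ι → κ → ℂ} (hW : IsEntrySummable W)
    (i : ι) : Summable fun j => ‖W i j‖ := by
  rw [← tsum_enorm_ne_top_iff_summable_norm]
  exact ne_top_of_le_ne_top hW (ENNReal.le_tsum i)

theorem IsEntrySummable.summable_rowSum {ι κ : Type} {W : ι → κ → ℂ} (hW : IsEntrySummable W) :
    Summable fun i => ∑' j, ‖W i j‖ := by
  have h := ENNReal.summable_toReal hW
  refine h.congr fun i => ?_
  rw [ENNReal.tsum_toReal_eq fun j => enorm_ne_top]
  simp

theorem norm_minor_le {K W : ℕ → ℕ → ℂ} (hW : IsEntrySummable W)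
    (h : ∀ i j, ‖K i j‖ ≤ ‖W i j‖) (s : Finset ℕ) :
    ‖(Matrix.of fun i j : s => K i j).det‖ ≤ ∏ i ∈ s, ∑' j, ‖W i j‖ := by
  refine (norm_det_le_prod_sum _).trans ?_
  rw [← Finset.prod_coe_sort s fun i => ∑' j, ‖W i j‖]
  refine Finset.prod_le_prod (fun (i : s) _ => Finset.sum_nonneg fun (j : s) _ =>
    norm_nonneg (K i j)) fun i _ => ?_
  simp only [Matrix.of_apply]
  rw [Finset.sum_coe_sort s fun j => ‖K i j‖]
  refine (Finset.sum_le_sum fun j _ => h i j).trans ?_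
  exact (hW.summable_row i).sum_le_tsum s fun _ _ => norm_nonneg _

theorem IsEntrySummable.summable_prod_rowSum {W : ℕ → ℕ → ℂ} (hW : IsEntrySummable W) :
    Summable fun s : Finset ℕ => ∏ i ∈ s, ∑' j, ‖W i j‖ :=
  summable_finsetProd_of_summable_nonneg (fun _ => tsum_nonneg fun _ => norm_nonneg _)
    hW.summable_rowSum

theorem IsEntrySummable.summable_minors {K : ℕ → ℕ → ℂ} (hK : IsEntrySummable K) :
    Summable fun s : Finset ℕ => ‖(Matrix.of fun i j : s => K i j).det‖ :=
  hK.summable_prod_rowSum.of_nonneg_of_le (fun _ => norm_nonneg _)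
    fun s => norm_minor_le hK (fun _ _ => le_rfl) s

theorem DomTendsto.minor {A : ℕ → ℕ → ℕ → ℂ} {B W : ℕ → ℕ → ℂ} (h : DomTendsto A B W)
    (s : Finset ℕ) :
    Tendsto (fun n => (Matrix.of fun i j : s => A n i j).det) atTop
      (𝓝 (Matrix.of fun i j : s => B i j).det) := by
  simp only [Matrix.det_apply, Units.smul_def, zsmul_eq_mul]
  exact tendsto_finsetSum _ fun π _ => tendsto_const_nhds.mul <|
    tendsto_finsetProd _ fun i _ => h.tendsto _ _

theorem DomTendsto.fredDet {A : ℕ → ℕ → ℕ → ℂ} {B W : ℕ → ℕ → ℂ} (h : DomTendsto A B W)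
    (hW : IsEntrySummable W) : Tendsto (fun n => fredDet (A n)) atTop (𝓝 (fredDet B)) :=
  tendsto_tsum_of_dominated_convergence hW.summable_prod_rowSum h.minor
    (Eventually.of_forall fun n s => norm_minor_le hW (h.bound n) s)

theorem fredDet_eq_det {K : ℕ → ℕ → ℂ} {N : ℕ} (h : ∀ i j, N ≤ i → K i j = 0) :
    fredDet K = (1 + Matrix.of fun i j : Fin N => K i j).det := by
  rw [Matrix.det_one_add_eq_sum_principal_minors, ← tsum_fintype (L := .unconditional _), fredDet]
  have hinj : Function.Injective (Finset.map (Fin.valEmbedding (n := N))) :=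
    Finset.map_injective _
  rw [← hinj.tsum_eq]
  · refine tsum_congr fun s => ?_
    rw [← Matrix.det_submatrix_equiv_self (s.equivMap Fin.valEmbedding)]
    rfl
  · intro s hs
    by_contra hcon
    apply hs
    obtain ⟨i, hi, hiN⟩ : ∃ i ∈ s, N ≤ i := by
      by_contra! hall
      apply hcon
      refine ⟨s.attachFin hall, ?_⟩
      ext a
      simp only [Finset.mem_map, Finset.mem_attachFin, Fin.valEmbedding_apply]
      exact ⟨fun ⟨b, hb, hba⟩ => hba ▸ hb, fun ha => ⟨⟨a, hall a ha⟩, ha, rfl⟩⟩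
    exact Matrix.det_eq_zero_of_row_eq_zero ⟨i, hi⟩ fun j => h i j hiN

/-- Truncation of an infinite matrix to its top left `N × N` corner. -/
def corner (N : ℕ) (K : ℕ → ℕ → ℂ) : ℕ → ℕ → ℂ := fun i j => if i < N ∧ j < N then K i j else 0

theorem domTendsto_corner (K : ℕ → ℕ → ℂ) : DomTendsto (fun N => corner N K) K K where
  tendsto i j := by
    refine tendsto_const_nhds.congr' ?_
    filter_upwards [eventually_gt_atTop i, eventually_gt_atTop j] with N hi hj
    simp [corner, hi, hj]
  bound N i j := by
    unfold corner
    split_ifs <;> simp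

theorem corner_apply_fin {N : ℕ} (K : ℕ → ℕ → ℂ) (i j : Fin N) : corner N K i j = K i j := by
  simp [corner]

theorem infMul_corner (N : ℕ) (K L : ℕ → ℕ → ℂ) (i j : ℕ) :
    infMul (corner N K) (corner N L) i j = ∑ k : Fin N, corner N K i k * corner N L k j := by
  rw [Fin.sum_univ_eq_sum_range fun k => corner N K i k * corner N L k j, infMul, tsum_eq_sum]
  intro k hk
  simp only [Finset.mem_range] at hk
  simp [corner, hk]

theorem infMul_corner_matrix (N : ℕ) (K L : ℕ → ℕ → ℂ) :
    (Matrix.of fun i j : Fin N => infMul (corner N K) (corner N L) i j) =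
      (Matrix.of fun i j : Fin N => K i j) * Matrix.of fun i j : Fin N => L i j := by
  ext i j
  simp [infMul_corner, Matrix.mul_apply, corner_apply_fin]

theorem infMul_corner_eq_zero {N : ℕ} (K L : ℕ → ℕ → ℂ) {i : ℕ} (hi : N ≤ i) (j : ℕ) :
    infMul (corner N K) (corner N L) i j = 0 := by
  simp [infMul, corner, hi.not_gt]

theorem tendsto_det_one_add {K : ℕ → ℕ → ℂ} (hK : IsEntrySummable K) :
    Tendsto (fun N : ℕ => (1 + Matrix.of fun i j : Fin N => K i j).det) atTop (𝓝 (fredDet K)) := by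
  refine ((domTendsto_corner K).fredDet hK).congr fun N => ?_
  rw [fredDet_eq_det (N := N) fun i j hi => by simp [corner, hi.not_gt]]
  simp only [corner_apply_fin]

theorem fredDet_mul {K L : ℕ → ℕ → ℂ} (hK : IsEntrySummable K) (hL : IsEntrySummable L) :
    fredDet (K + L + infMul K L) = fredDet K * fredDet L := by
  have hKL := ((domTendsto_corner K).add (domTendsto_corner L)).add
    ((domTendsto_corner K).infMul (domTendsto_corner L) hK.isSchur hL.isSchur)
  have h := hKL.fredDet (((hK.normMatrix.add hL.normMatrix).normMatrix).add
    (hK.normMatrix.infMul_right hL.normMatrix.isSchur).normMatrix)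
  refine tendsto_nhds_unique h (((tendsto_det_one_add hK).mul (tendsto_det_one_add hL)).congr
    fun N => ?_)
  rw [fredDet_eq_det (N := N) fun i j hi => by
    simp [infMul_corner_eq_zero K L hi, corner, hi.not_gt], ← Matrix.det_mul]
  congr 1
  have : (Matrix.of fun i j : Fin N =>
      (corner N K + corner N L + infMul (corner N K) (corner N L)) i j) =
      (Matrix.of fun i j : Fin N => K i j) + (Matrix.of fun i j : Fin N => L i j) +
        Matrix.of fun i j : Fin N => infMul (corner N K) (corner N L) i j := by
    ext i j
    simp [corner_apply_fin]
  rw [this, infMul_corner_matrix]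
  noncomm_ring

theorem fredDet_infMul_comm {A B : ℕ → ℕ → ℂ} (hA : IsEntrySummable A) (hB : IsSchur B) :
    fredDet (infMul A B) = fredDet (infMul B A) := by
  have h₁ := ((domTendsto_corner A).infMul (domTendsto_corner B) hA.isSchur hB).fredDet
    (hA.normMatrix.infMul_right hB.normMatrix)
  have h₂ := ((domTendsto_corner B).infMul (domTendsto_corner A) hB hA.isSchur).fredDet
    (IsEntrySummable.infMul_left hB.normMatrix hA.normMatrix)
  refine tendsto_nhds_unique h₁ (h₂.congr fun N => ?_)
  rw [fredDet_eq_det (N := N) fun i j hi => infMul_corner_eq_zero B A hi j,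
    fredDet_eq_det (N := N) fun i j hi => infMul_corner_eq_zero A B hi j,
    infMul_corner_matrix, infMul_corner_matrix, Matrix.det_one_add_mul_comm]

theorem fredDet_transpose (K : ℕ → ℕ → ℂ) : fredDet (fun i j => K j i) = fredDet K := by
  refine tsum_congr fun s => ?_
  rw [← Matrix.det_transpose]
  rfl

theorem summable_and_tsum_prod_fin {α : Type} {N : ℕ} (f : Fin N → α → ℂ)
    (hf : ∀ i, Summable fun a => ‖f i a‖) :
    (Summable fun p : Fin N → α => ‖∏ i, f i (p i)‖) ∧
      ∑' p : Fin N → α, ∏ i, f i (p i) = ∏ i, ∑' a, f i a := by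
  induction N with
  | zero =>
    refine ⟨Summable.of_finite, ?_⟩
    rw [tsum_fintype]
    simp
  | succ N ih =>
    obtain ⟨h₁, h₂⟩ := ih (fun i => f i.succ) fun i => hf i.succ
    have hs := (hf 0).mul_of_nonneg h₁ (fun _ => norm_nonneg _) fun _ => norm_nonneg _
    have key : ∀ x : α × (Fin N → α),
        ∏ i, f i (Fin.consEquiv (fun _ => α) x i) = f 0 x.1 * ∏ i : Fin N, f i.succ (x.2 i) := by
      intro x
      simp [Fin.prod_univ_succ, Fin.consEquiv]
    constructor
    · rw [← (Fin.consEquiv fun _ : Fin (N + 1) => α).summable_iff]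
      refine hs.congr fun x => ?_
      rw [Function.comp_apply, key, norm_mul]
    · rw [← (Fin.consEquiv fun _ : Fin (N + 1) => α).tsum_eq, Fin.prod_univ_succ, ← h₂,
        tsum_mul_tsum_of_summable_norm (hf 0) h₁]
      exact tsum_congr key

/-- An injective tuple is a strictly monotone tuple composed with a permutation. -/
def strictMonoProdPermEquiv (α : Type) [LinearOrder α] (N : ℕ) :
    {q : Fin N → α // StrictMono q} × Equiv.Perm (Fin N) ≃
      {p : Fin N → α // Function.Injective p} :=
  Equiv.ofBijective (fun x => ⟨x.1.1 ∘ x.2, x.1.2.injective.comp x.2.injective⟩) <| by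
    constructor
    · rintro ⟨⟨q, hq⟩, τ⟩ ⟨⟨q', hq'⟩, τ'⟩ h
      have h : q ∘ τ = q' ∘ τ' := congrArg Subtype.val h
      have hqq : q = q' := by
        rw [← hq.range_inj hq', ← τ.surjective.range_comp q, h, τ'.surjective.range_comp]
      subst hqq
      have : τ = τ' := Equiv.ext fun i => hq.injective (congrFun h i)
      rw [this]
    · rintro ⟨p, hp⟩
      refine ⟨⟨⟨p ∘ Tuple.sort p, (Tuple.monotone_sort p).strictMono_of_injective
        (hp.comp (Tuple.sort p).injective)⟩, (Tuple.sort p)⁻¹⟩, Subtype.ext ?_⟩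
      ext i
      simp

theorem tsum_eq_tsum_strictMono_sum_perm {α : Type} [LinearOrder α] {N : ℕ}
    (F : (Fin N → α) → ℂ) (h0 : ∀ p, ¬ Function.Injective p → F p = 0) 
    (hF : ∀ τ : Equiv.Perm (Fin N),
      Summable fun q : {q : Fin N → α // StrictMono q} => ‖F (q.1 ∘ τ)‖) :
    ∑' p, F p = ∑' q : {q : Fin N → α // StrictMono q}, ∑ τ : Equiv.Perm (Fin N), F (q.1 ∘ τ) := by
  have hsupp : Function.support F ⊆ {p | Function.Injective p} := fun p hp => by
    by_contra h
    exact hp (h0 p h)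
  have hsum : Summable fun x : {q : Fin N → α // StrictMono q} × Equiv.Perm (Fin N) =>
      F (x.1.1 ∘ x.2) := by
    apply Summable.of_norm
    rw [← (Equiv.prodComm _ _).summable_iff]
    refine (summable_prod_of_nonneg fun _ => norm_nonneg _).2 ⟨fun τ => hF τ, Summable.of_finite⟩
  rw [← tsum_subtype_eq_of_support_subset hsupp]
  refine Eq.trans ((strictMonoProdPermEquiv α N).tsum_eq
    fun p : {p : Fin N → α // Function.Injective p} => F p.1).symm ?_
  change ∑' x : {q : Fin N → α // StrictMono q} × Equiv.Perm (Fin N), F (x.1.1 ∘ x.2) = _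
  rw [hsum.tsum_prod]
  exact tsum_congr fun q => tsum_fintype _

theorem det_of_tsum_mul {α : Type} [LinearOrder α] {N : ℕ} (a b : Fin N → α → ℂ)
    (h : ∀ i j, Summable fun s => ‖a i s * b j s‖) :
    (Matrix.of fun i j => ∑' s, a i s * b j s).det =
      ∑' q : {q : Fin N → α // StrictMono q},
        (Matrix.of fun i j => a i (q.1 j)).det * (Matrix.of fun i j => b i (q.1 j)).det := by
  have hprod := fun π : Equiv.Perm (Fin N) =>
    summable_and_tsum_prod_fin (fun j s => a (π j) s * b j s) fun j => h (π j) j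
  have hexp : ∀ p : Fin N → α, (Matrix.of fun i j => a i (p j)).det * ∏ j, b j (p j) =
      ∑ π : Equiv.Perm (Fin N), (Equiv.Perm.sign π : ℂ) * ∏ j, (a (π j) (p j) * b j (p j)) := by
    intro p
    rw [Matrix.det_apply', Finset.sum_mul]
    refine Finset.sum_congr rfl fun π _ => ?_
    simp [Finset.prod_mul_distrib, mul_assoc]
  have hF : Summable fun p : Fin N → α =>
      ‖(Matrix.of fun i j => a i (p j)).det * ∏ j, b j (p j)‖ := by
    apply Summable.norm
    simp only [hexp]
    exact summable_sum fun π _ => (hprod π).1.of_norm.mul_left _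
  calc (Matrix.of fun i j => ∑' s, a i s * b j s).det
      = ∑' p : Fin N → α, (Matrix.of fun i j => a i (p j)).det * ∏ j, b j (p j) := by
        simp only [hexp]
        rw [Summable.tsum_finsetSum fun π _ => (hprod π).1.of_norm.mul_left _, Matrix.det_apply']
        refine Finset.sum_congr rfl fun π _ => ?_
        rw [tsum_mul_left, (hprod π).2]
        rfl
    _ = _ := by
        rw [tsum_eq_tsum_strictMono_sum_perm]
        · refine tsum_congr fun q => ?_
          rw [← Matrix.det_transpose (Matrix.of fun i j => b i (q.1 j)),
            Matrix.det_apply' (Matrix.of fun i j => b i (q.1 j)).transpose, Finset.mul_sum]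
          refine Finset.sum_congr rfl fun τ _ => ?_
          have := Matrix.det_permute' τ (Matrix.of fun i j => a i (q.1 j))
          have h' : (Matrix.of fun i j => a i ((q.1 ∘ τ) j)) =
            (Matrix.of fun i j => a i (q.1 j)).submatrix id τ := rfl
          rw [h', this]
          simp only [Function.comp_apply, Matrix.transpose_apply, Matrix.of_apply]
          ring
        · intro p hp
          rw [Function.not_injective_iff] at hp
          obtain ⟨i, j, hij, hne⟩ := hp
          rw [Matrix.det_zero_of_column_eq hne fun k => by simp [hij], zero_mul]
        · intro τ
          refine hF.comp_injective (i := fun q : {q : Fin N → α // StrictMono q} => q.1 ∘ τ) ?_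
          exact fun q q' hqq => Subtype.ext (τ.surjective.injective_comp_right hqq)

/-- Finite subsets of `ℕ` correspond to strictly monotone tuples of arbitrary length. -/
def sigmaStrictMonoEquivFinset : (Σ m : ℕ, {q : Fin m → ℕ // StrictMono q}) ≃ Finset ℕ :=
  Equiv.ofBijective (fun x => Finset.univ.map ⟨x.2.1, x.2.2.injective⟩) <| by
    constructor
    · rintro ⟨m, q, hq⟩ ⟨m', q', hq'⟩ h
      obtain rfl : m = m' := by simpa using congrArg Finset.card h
      have : Set.range q = Set.range q' := by
        simpa using congrArg (fun s : Finset ℕ => (s : Set ℕ)) h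
      rw [hq.range_inj hq'] at this
      subst this
      rfl
    · intro s
      refine ⟨⟨s.card, s.orderEmbOfFin rfl, (s.orderEmbOfFin rfl).strictMono⟩, ?_⟩
      apply Finset.coe_injective
      simp

theorem minor_sigmaStrictMonoEquivFinset (K : ℕ → ℕ → ℂ)
    (x : Σ m : ℕ, {q : Fin m → ℕ // StrictMono q}) :
    (Matrix.of fun i j : sigmaStrictMonoEquivFinset x => K i j).det =
      (Matrix.of fun i j : Fin x.1 => K (x.2.1 i) (x.2.1 j)).det := by
  let e : Fin x.1 ≃ sigmaStrictMonoEquivFinset x :=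
    (Equiv.subtypeUnivEquiv fun i => Finset.mem_univ i).symm.trans
      (Finset.univ.equivMap ⟨x.2.1, x.2.2.injective⟩)
  exact (Matrix.det_submatrix_equiv_self e _).symm

/-- The half-line `{a : ℤ // n ≤ a}` is a copy of `ℕ`. -/
def intHalfLineEquiv (n : ℤ) : ℕ ≃ {a : ℤ // n ≤ a} where
  toFun i := ⟨n + i, by omega⟩
  invFun a := (a.1 - n).toNat
  left_inv i := by simp
  right_inv a := Subtype.ext (by have := a.2; simp only; omega)

theorem fredholmSeries_eq_fredDet (K : ℤ → ℤ → ℂ) (n : ℤ) (L : ℕ → ℕ → ℂ)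
    (hL : ∀ i j : ℕ, L i j = -K (n + i) (n + j)) (hLs : IsEntrySummable L) :
    fredholmSeries K n = fredDet L := by
  have hsum := sigmaStrictMonoEquivFinset.summable_iff.2 hLs.summable_minors
  have hsum' := sigmaStrictMonoEquivFinset.summable_iff.2 hLs.summable_minors.of_norm
  rw [fredDet, ← sigmaStrictMonoEquivFinset.tsum_eq]
  refine Eq.trans ?_ hsum'.tsum_sigma.symm
  refine tsum_congr fun m => ?_
  simp only [Function.comp_apply, minor_sigmaStrictMonoEquivFinset]
  have hdet : ∀ x : Fin m → ℕ,
      (Matrix.of fun i j => K (intHalfLineEquiv n (x i)) (intHalfLineEquiv n (x j))).det =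
        (-1) ^ m * (Matrix.of fun i j => L (x i) (x j)).det := by
    intro x
    have : (Matrix.of fun i j => K (intHalfLineEquiv n (x i)) (intHalfLineEquiv n (x j))) =
      -(Matrix.of fun i j => L (x i) (x j)) := by
      ext i j
      simp [hL, intHalfLineEquiv]
    rw [this, Matrix.det_neg, Fintype.card_fin]
  rw [← ((Equiv.refl (Fin m)).arrowCongr (intHalfLineEquiv n)).tsum_eq]
  change _ * ∑' x : Fin m → ℕ,
    (Matrix.of fun i j => K (intHalfLineEquiv n (x i)) (intHalfLineEquiv n (x j))).det = _
  simp only [hdet]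
  have hperm : ∀ (q : Fin m → ℕ) (τ : Equiv.Perm (Fin m)),
      (Matrix.of fun i j => L ((q ∘ τ) i) ((q ∘ τ) j)).det =
        (Matrix.of fun i j => L (q i) (q j)).det := fun q τ =>
    Matrix.det_submatrix_equiv_self τ (Matrix.of fun i j => L (q i) (q j))
  rw [tsum_mul_left, tsum_eq_tsum_strictMono_sum_perm]
  · simp only [hperm, Finset.sum_const, Finset.card_univ, Fintype.card_perm, Fintype.card_fin,
      nsmul_eq_mul, tsum_mul_left]
    have h1 : ((-1 : ℂ) ^ m) * (-1) ^ m = 1 := by rw [← mul_pow]; simp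
    have h2 : (m.factorial : ℂ) ≠ 0 := by exact_mod_cast m.factorial_ne_zero
    field_simp
    linear_combination (∑' q : {q : Fin m → ℕ // StrictMono q},
      (Matrix.of fun i j => L (q.1 i) (q.1 j)).det) * h1
  · intro p hp
    rw [Function.not_injective_iff] at hp
    obtain ⟨i, j, hij, hne⟩ := hp
    exact Matrix.det_zero_of_row_eq hne (by ext k; simp [hij])
  · intro τ
    simp only [hperm]
    refine (hsum.comp_injective (sigma_mk_injective (i := m))).congr fun q => ?_
    simp only [Function.comp_apply, minor_sigmaStrictMonoEquivFinset]

/-- The `k`-th Fourier coefficient of a function on the unit circle. -/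
def circleCoeff (f : ℂ → ℂ) (k : ℤ) : ℂ :=
  (2 * Real.pi : ℂ)⁻¹ *
    ∫ θ in (0:ℝ)..(2 * Real.pi),
      f (Complex.exp (θ * Complex.I)) * Complex.exp (-(k : ℂ) * θ * Complex.I)

theorem integral_exp_int_mul (m : ℤ) :
    ∫ θ in (0:ℝ)..(2 * Real.pi), Complex.exp ((m : ℂ) * Complex.I * θ) =
      if m = 0 then (2 * Real.pi : ℂ) else 0 := by
  split_ifs with h
  · simp [h]
  · have hc : (m : ℂ) * Complex.I ≠ 0 :=
      mul_ne_zero (by exact_mod_cast h) Complex.I_ne_zero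
    rw [integral_exp_mul_complex hc]
    have : Complex.exp ((m : ℂ) * Complex.I * ((2 * Real.pi : ℝ) : ℂ)) = 1 := by
      rw [← Complex.exp_int_mul_two_pi_mul_I m]
      congr 1
      push_cast
      ring
    rw [this]
    simp

theorem circleCoeff_eq_tsum {ι : Type} [Countable ι] {f : ℂ → ℂ} (c : ι → ℂ) (n : ι → ℤ)
    (hc : Summable fun i => ‖c i‖) (hf : ∀ z, ‖z‖ = 1 → f z = ∑' i, c i * z ^ n i) (k : ℤ) :
    circleCoeff f k = ∑' i, if n i = k then c i else 0 := by
  have hnorm : ∀ i (θ : ℝ), ‖c i * Complex.exp (θ * Complex.I) ^ n i *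
      Complex.exp (-(k : ℂ) * θ * Complex.I)‖ = ‖c i‖ := by
    intro i θ
    have : Complex.exp (-(k : ℂ) * θ * Complex.I) =
        Complex.exp (((-k * θ : ℝ) : ℂ) * Complex.I) := by push_cast; rfl
    rw [this, norm_mul, norm_mul, norm_zpow, Complex.norm_exp_ofReal_mul_I,
      Complex.norm_exp_ofReal_mul_I]
    simp
  have hint := intervalIntegral.hasSum_integral_of_dominated_convergence
    (μ := MeasureTheory.volume) (a := (0 : ℝ)) (b := 2 * Real.pi)
    (F := fun i (θ : ℝ) => c i * Complex.exp (θ * Complex.I) ^ n i *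
      Complex.exp (-(k : ℂ) * θ * Complex.I))
    (f := fun θ => f (Complex.exp (θ * Complex.I)) * Complex.exp (-(k : ℂ) * θ * Complex.I))
    (fun i _ => ‖c i‖)
    (fun i => by
      refine Continuous.aestronglyMeasurable ?_
      refine (continuous_const.mul (Continuous.zpow₀ (by fun_prop) _ fun θ => ?_)).mul (by fun_prop)
      exact Or.inl (Complex.exp_ne_zero _))
    (fun i => Eventually.of_forall fun θ _ => (hnorm i θ).le)
    (Eventually.of_forall fun θ _ => hc)
    (by simp)
    (Eventually.of_forall fun θ _ => by
      have hz := Complex.norm_exp_ofReal_mul_I θ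
      rw [hf _ hz]
      refine (Summable.hasSum ?_).mul_right _
      exact Summable.of_norm (hc.congr fun i => by rw [norm_mul, norm_zpow, hz, one_zpow, mul_one]))
  rw [circleCoeff, ← hint.tsum_eq, ← tsum_mul_left]
  refine tsum_congr fun i => ?_
  have : ∀ θ : ℝ, c i * Complex.exp (θ * Complex.I) ^ n i * Complex.exp (-(k : ℂ) * θ * Complex.I) =
      c i * Complex.exp (((n i - k : ℤ) : ℂ) * Complex.I * θ) := by
    intro θ
    rw [← Complex.exp_int_mul, mul_assoc, ← Complex.exp_add]
    congr 2
    push_cast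
    ring
  simp only [this]
  rw [intervalIntegral.integral_const_mul, integral_exp_int_mul]
  have hpi : (2 * Real.pi : ℂ) ≠ 0 := by exact_mod_cast Real.two_pi_pos.ne'
  by_cases h : n i = k
  · rw [if_pos (by omega), if_pos h]
    field_simp
  · rw [if_neg (by omega), if_neg h]
    simp

/-- `f` is given on the unit circle by the absolutely convergent Laurent series with
coefficients `a`. -/
structure IsLaurent (f : ℂ → ℂ) (a : ℤ → ℂ) : Prop where
  summable : Summable fun k => ‖a k‖
  eq_tsum : ∀ z, ‖z‖ = 1 → f z = ∑' k, a k * z ^ k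

theorem IsLaurent.circleCoeff_eq {f : ℂ → ℂ} {a : ℤ → ℂ} (h : IsLaurent f a) (k : ℤ) :
    circleCoeff f k = a k := by
  rw [circleCoeff_eq_tsum a id h.summable h.eq_tsum]
  simp

theorem IsLaurent.summable_mul_zpow {f : ℂ → ℂ} {a : ℤ → ℂ} (h : IsLaurent f a) {z : ℂ}
    (hz : ‖z‖ = 1) : Summable fun k => ‖a k * z ^ k‖ :=
  h.summable.congr fun k => by rw [norm_mul, norm_zpow, hz, one_zpow, mul_one]

theorem IsLaurent.inv {f : ℂ → ℂ} {a : ℤ → ℂ} (h : IsLaurent f a) :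
    IsLaurent (fun z => f z⁻¹) fun k => a (-k) where
  summable := (Equiv.neg ℤ).summable_iff.2 h.summable
  eq_tsum z hz := by
    rw [h.eq_tsum _ (by rw [norm_inv, hz, inv_one]), ← (Equiv.neg ℤ).tsum_eq]
    simp

theorem IsLaurent.circleCoeff_mul {f g : ℂ → ℂ} {a b : ℤ → ℂ} (hf : IsLaurent f a)
    (hg : IsLaurent g b) (m : ℤ) :
    circleCoeff (fun z => f z * g z) m = ∑' l, a (m - l) * b l := by
  rw [circleCoeff_eq_tsum (fun p : ℤ × ℤ => a p.1 * b p.2) (fun p => p.1 + p.2)]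
  · have hinj : Function.Injective fun l : ℤ => (m - l, l) := fun l l' h => (Prod.ext_iff.1 h).2
    rw [← hinj.tsum_eq]
    · simp
    · rintro ⟨p, q⟩ h
      have : p + q = m := by
        by_contra hne
        simp [hne] at h
      exact ⟨q, by ext <;> simp; omega⟩
  · simpa only [norm_mul] using hf.summable.mul_of_nonneg hg.summable (fun _ => norm_nonneg _)
      fun _ => norm_nonneg _
  · intro z hz
    have hz0 : z ≠ 0 := by
      rintro rfl
      simp at hz
    rw [hf.eq_tsum z hz, hg.eq_tsum z hz,
      tsum_mul_tsum_of_summable_norm (hf.summable_mul_zpow hz) (hg.summable_mul_zpow hz)]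
    refine tsum_congr fun p => ?_
    rw [zpow_add₀ hz0]
    ring

/-- A function bounded by `C` on a disc of radius `R > ρ > 1` has a Laurent expansion on the
unit circle with only nonnegative powers and geometrically decaying coefficients. -/
theorem exists_isLaurent_of_differentiableOn {f : ℂ → ℂ} {R ρ C : ℝ} (hρ : 1 < ρ) (hρR : ρ < R)
    (hf : DifferentiableOn ℂ f (Metric.ball 0 R)) (hC : ∀ z, ‖z‖ < R → ‖f z‖ ≤ C) :
    ∃ a : ℤ → ℂ, IsLaurent f a ∧ (∀ k < 0, a k = 0) ∧ a 0 = f 0 ∧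
      ∀ k : ℕ, ‖a k‖ ≤ C * ρ⁻¹ ^ k := by
  have hρ0 : 0 < ρ := one_pos.trans hρ
  let d : ℕ → ℂ := fun k => (k.factorial : ℂ)⁻¹ * iteratedDeriv k f 0
  have hd : ∀ k, ‖d k‖ ≤ C * ρ⁻¹ ^ k := by
    intro k
    have h := Complex.norm_iteratedDeriv_le_of_forall_mem_sphere_norm_le (c := 0) (f := f) (C := C)
      k hρ0 (hf.diffContOnCl_ball (Metric.closedBall_subset_ball hρR)) fun z hz => by
        refine hC z ?_
        rw [mem_sphere_zero_iff_norm.1 hz]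
        exact hρR
    have hk : (0 : ℝ) < k.factorial := by exact_mod_cast k.factorial_pos
    rw [norm_mul, norm_inv, Complex.norm_natCast, inv_mul_le_iff₀ hk]
    refine h.trans_eq ?_
    rw [inv_pow]
    ring
  have hds : Summable fun k => ‖d k‖ :=
    Summable.of_nonneg_of_le (fun _ => norm_nonneg _) hd
      ((summable_geometric_of_lt_one (by positivity) (inv_lt_one_of_one_lt₀ hρ)).mul_left _)
  let a : ℤ → ℂ := fun k => if k < 0 then 0 else d k.toNat
  have ha : ∀ k : ℕ, a k = d k := fun k => by simp [a]
  have hsupp : ∀ g : ℤ → ℂ, Function.support (fun k => a k * g k) ⊆ Set.range ((↑) : ℕ → ℤ) := by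
    intro g k hk
    have : 0 ≤ k := by
      by_contra h
      exact hk (by simp [a, not_le.1 h])
    exact ⟨k.toNat, by simp [this]⟩
  refine ⟨a, ⟨?_, fun z hz => ?_⟩, fun k hk => by simp [a, hk], ?_, fun k => (ha k).symm ▸ hd k⟩
  · rw [← Nat.cast_injective.summable_iff (f := fun k : ℤ => ‖a k‖)]
    · exact hds.congr fun k => by simp only [Function.comp_apply, ha]
    · intro k hk
      have : k < 0 := by
        by_contra h
        exact hk ⟨k.toNat, by simp; omega⟩
      simp [a, this]
  · rw [← (Nat.cast_injective (R := ℤ)).tsum_eq (hsupp _)]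
    have h := Complex.hasSum_taylorSeries_on_ball hf (z := z) (by
      rw [mem_ball_zero_iff, hz]
      exact hρ.trans hρR)
    rw [← h.tsum_eq]
    refine tsum_congr fun k => ?_
    simp [ha, d]
    ring
  · have := ha 0
    simpa [d] using this

theorem RSummable.smul {R : ℝ} {t : ℕ → ℂ} (ht : RSummable R t) (c : ℂ) : RSummable R (c • t) :=
  (Summable.mul_left ‖c‖ ht).congr fun n => by simp [mul_assoc]

theorem RSummable.neg {R : ℝ} {t : ℕ → ℂ} (ht : RSummable R t) : RSummable R (-t) :=
  Summable.congr ht fun n => by simp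

theorem RSummable.add {R : ℝ} (hR : 0 ≤ R) {t s : ℕ → ℂ} (ht : RSummable R t)
    (hs : RSummable R s) : RSummable R (t + s) :=
  Summable.of_nonneg_of_le (fun n => by positivity)
    (fun n => by
      rw [← add_mul]
      exact mul_le_mul_of_nonneg_right (norm_add_le _ _) (by positivity))
    (Summable.add ht hs)

section Gamma

variable {R : ℝ} {t : ℕ → ℂ}

theorem norm_mul_pow_le_of_norm_le (z : ℂ) (hz : ‖z‖ ≤ R) (n : ℕ) :
    ‖t n * z ^ (n + 1)‖ ≤ ‖t n‖ * R ^ (n + 1) := by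
  rw [norm_mul, norm_pow]
  gcongr

theorem RSummable.summable_mul_pow (ht : RSummable R t) {z : ℂ} (hz : ‖z‖ ≤ R) :
    Summable fun n => ‖t n * z ^ (n + 1)‖ :=
  Summable.of_nonneg_of_le (fun _ => norm_nonneg _) (norm_mul_pow_le_of_norm_le z hz) ht

theorem RSummable.norm_tsum_le (ht : RSummable R t) {z : ℂ} (hz : ‖z‖ ≤ R) :
    ‖∑' n, t n * z ^ (n + 1)‖ ≤ ∑' n, ‖t n‖ * R ^ (n + 1) :=
  tsum_of_norm_bounded ht.hasSum (norm_mul_pow_le_of_norm_le z hz)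

theorem RSummable.differentiableOn (ht : RSummable R t) :
    DifferentiableOn ℂ (fun z => ∑' n, t n * z ^ (n + 1)) (Metric.ball 0 R) :=
  Complex.differentiableOn_tsum_of_summable_norm ht (fun n => by fun_prop) Metric.isOpen_ball
    fun n w hw => norm_mul_pow_le_of_norm_le w (mem_ball_zero_iff.1 hw).le n

theorem RSummable.differentiableOn_gammaFn (ht : RSummable R t) :
    DifferentiableOn ℂ (fun z => gammaFn z t) (Metric.ball 0 R) :=
  ht.differentiableOn.cexp

theorem gammaFn_add (ht : RSummable R t) {s : ℕ → ℂ} (hs : RSummable R s) {z : ℂ}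
    (hz : ‖z‖ ≤ R) : gammaFn z (t + s) = gammaFn z t * gammaFn z s := by
  rw [gammaFn, gammaFn, gammaFn, ← Complex.exp_add,
    ← (ht.summable_mul_pow hz).of_norm.tsum_add (hs.summable_mul_pow hz).of_norm]
  simp [add_mul]

theorem gammaFn_smul (c z : ℂ) : gammaFn z (c • t) = Complex.exp (c * ∑' n, t n * z ^ (n + 1)) := by
  rw [gammaFn, ← tsum_mul_left]
  simp [mul_assoc]

theorem gammaFn_zero_left : gammaFn 0 t = 1 := by
  simp [gammaFn]

theorem hcoef_of_neg {k : ℤ} (hk : k < 0) : hcoef t k = 0 := if_pos hk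

theorem isLaurent_gammaFn (hR : 1 < R) (ht : RSummable R t) :
    IsLaurent (fun z => gammaFn z t) (hcoef t) ∧ hcoef t 0 = 1 := by
  obtain ⟨ρ, hρ, hρR⟩ := exists_between hR
  obtain ⟨a, ha, hneg, h0, -⟩ := exists_isLaurent_of_differentiableOn hρ hρR
    ht.differentiableOn_gammaFn (C := Real.exp (∑' n, ‖t n‖ * R ^ (n + 1))) fun z hz => by
      rw [gammaFn, Complex.norm_exp]
      exact Real.exp_le_exp.2 ((Complex.re_le_norm _).trans (ht.norm_tsum_le hz.le))
  have : hcoef t = a := by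
    ext k
    by_cases hk : k < 0
    · rw [hcoef_of_neg hk, hneg k hk]
    · rw [hcoef, if_neg hk, ← ha.circleCoeff_eq k]
      rfl
  rw [this, h0, gammaFn_zero_left]
  exact ⟨ha, rfl⟩

theorem hcoef_zero (hR : 1 < R) (ht : RSummable R t) : hcoef t 0 = 1 :=
  (isLaurent_gammaFn hR ht).2

theorem IsLaurent.ext {f : ℂ → ℂ} {a b : ℤ → ℂ} (ha : IsLaurent f a) (hb : IsLaurent f b) :
    a = b := by
  ext k
  rw [← ha.circleCoeff_eq, hb.circleCoeff_eq]

theorem IsLaurent.add {f g : ℂ → ℂ} {a b : ℤ → ℂ} (ha : IsLaurent f a) (hb : IsLaurent g b) :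
    IsLaurent (fun z => f z + g z) fun k => a k + b k where
  summable := Summable.of_nonneg_of_le (fun _ => norm_nonneg _) (fun _ => norm_add_le _ _)
    (ha.summable.add hb.summable)
  eq_tsum z hz := by
    rw [ha.eq_tsum z hz, hb.eq_tsum z hz,
      ← (ha.summable_mul_zpow hz).of_norm.tsum_add (hb.summable_mul_zpow hz).of_norm]
    simp [add_mul]

/-- The Laurent coefficients of `1 + c ∑ t_n z^n`. -/
def linCoeff (c : ℂ) (t : ℕ → ℂ) : ℤ → ℂ
  | Int.ofNat 0 => 1
  | Int.ofNat (k + 1) => c * t k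
  | Int.negSucc _ => 0

theorem isLaurent_linCoeff (hR : 1 < R) (ht : RSummable R t) (c : ℂ) :
    IsLaurent (fun z => 1 + c * ∑' n, t n * z ^ (n + 1)) (linCoeff c t) := by
  have key : ∀ z : ℂ, ‖z‖ = 1 → HasSum (fun k : ℤ => linCoeff c t k * z ^ k)
      (1 + c * ∑' n, t n * z ^ (n + 1)) := by
    intro z hz
    have h1 : HasSum (fun n : ℕ => linCoeff c t ((n + 1 : ℕ) : ℤ) * z ^ (((n + 1 : ℕ) : ℤ)))
        (c * ∑' n, t n * z ^ (n + 1)) := by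
      refine ((ht.summable_mul_pow (hz.trans_le hR.le)).of_norm.hasSum.mul_left c).congr_fun ?_
      intro n
      rw [zpow_natCast]
      change c * t n * _ = _
      ring
    have h2 := (hasSum_nat_add_iff (f := fun n : ℕ => linCoeff c t (n : ℤ) * z ^ (n : ℤ)) 1).1 h1
    have h3 : HasSum (fun n : ℕ => linCoeff c t (-(n + 1 : ℤ)) * z ^ (-(n + 1 : ℤ))) 0 := by
      have h0 : ∀ n : ℕ, linCoeff c t (-(n + 1 : ℤ)) = 0 := fun n => by
        rw [← Int.negSucc_eq]
        rfl
      simp only [h0, zero_mul]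
      exact hasSum_zero
    have h4 := HasSum.of_nat_of_neg_add_one (f := fun k : ℤ => linCoeff c t k * z ^ k) h2 h3
    have h5 : linCoeff c t 0 = 1 := rfl
    rw [Finset.sum_range_one, Nat.cast_zero, h5, zpow_zero, mul_one, add_zero, add_comm] at h4
    exact h4
  refine ⟨?_, fun z hz => (key z hz).tsum_eq.symm⟩
  have := (key 1 norm_one).summable.norm
  simpa using this

theorem exists_hcoef_bounds (hR : 1 < R) (ht : RSummable R t) :
    ∃ r C : ℝ, 0 < r ∧ r < 1 ∧ ∀ c : ℂ, ‖c‖ ≤ 1 → ∀ k : ℕ,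
      ‖hcoef (c • t) k‖ ≤ C * r ^ k ∧ ‖t k‖ ≤ C * r ^ k ∧
      ‖hcoef (c • t) (k + 1 : ℕ) - c * t k‖ ≤ ‖c‖ ^ 2 * (C * r ^ k) := by
  obtain ⟨ρ, hρ, hρR⟩ := exists_between hR
  have hρ0 : 0 < ρ := one_pos.trans hρ
  set S := ∑' n, ‖t n‖ * R ^ (n + 1) with hS
  have hS0 : 0 ≤ S := tsum_nonneg fun n => by positivity
  have hr1 : ρ⁻¹ < 1 := inv_lt_one_of_one_lt₀ hρ
  set C := max (Real.exp S) (max S (S ^ 2 * Real.exp S)) with hCdef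
  refine ⟨ρ⁻¹, C, by positivity, hr1, fun c hc k => ⟨?_, ?_, ?_⟩⟩
  · obtain ⟨a, ha, hneg, h0, hb⟩ := exists_isLaurent_of_differentiableOn hρ hρR
      (ht.smul c).differentiableOn_gammaFn (C := Real.exp S) fun z hz => by
        rw [gammaFn_smul, Complex.norm_exp]
        refine Real.exp_le_exp.2 ((Complex.re_le_norm _).trans ?_)
        rw [norm_mul]
        exact (mul_le_of_le_one_left (norm_nonneg _) hc).trans (ht.norm_tsum_le hz.le)
    rw [(isLaurent_gammaFn hR (ht.smul c)).1.ext ha]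
    refine (hb k).trans ?_
    gcongr
    exact le_max_left _ _
  · have h1 : ‖t k‖ * R ^ (k + 1) ≤ S := ht.le_tsum k fun n _ => by positivity
    have h2 : ‖t k‖ * ρ ^ k ≤ S := by
      refine le_trans ?_ h1
      gcongr
      calc ρ ^ k ≤ ρ ^ (k + 1) := pow_le_pow_right₀ hρ.le (Nat.le_succ k)
        _ ≤ R ^ (k + 1) := by gcongr
    calc ‖t k‖ = ‖t k‖ * ρ ^ k * ρ⁻¹ ^ k := by
          rw [mul_assoc, ← mul_pow, mul_inv_cancel₀ hρ0.ne', one_pow, mul_one]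
      _ ≤ C * ρ⁻¹ ^ k := by
        gcongr
        exact h2.trans ((le_max_left _ _).trans (le_max_right _ _))
  · obtain ⟨a, ha, -, -, hb⟩ := exists_isLaurent_of_differentiableOn hρ hρR
      (f := fun z => gammaFn z (c • t) - (1 + c * ∑' n, t n * z ^ (n + 1)))
      ((ht.smul c).differentiableOn_gammaFn.sub
        ((differentiableOn_const _).add ((differentiableOn_const _).mul ht.differentiableOn)))
      (C := ‖c‖ ^ 2 * (S ^ 2 * Real.exp S)) fun z hz => by
        have h := Complex.norm_exp_sub_sum_le_norm_mul_exp (c * ∑' n, t n * z ^ (n + 1)) 2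
        rw [← gammaFn_smul] at h
        simp only [Finset.sum_range_succ, Finset.range_zero, Finset.sum_empty] at h
        norm_num at h
        refine h.trans ?_
        have h3 := ht.norm_tsum_le hz.le
        have h4 : ‖c‖ * ‖∑' n, t n * z ^ (n + 1)‖ ≤ S :=
          (mul_le_of_le_one_left (norm_nonneg _) hc).trans h3
        rw [mul_pow, ← mul_assoc]
        gcongr
    have hsum := ha.add (isLaurent_linCoeff hR ht c)
    simp only [sub_add_cancel] at hsum
    rw [(isLaurent_gammaFn hR (ht.smul c)).1.ext hsum]
    have h1 : linCoeff c t ((k + 1 : ℕ) : ℤ) = c * t k := rfl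
    simp only [h1, add_sub_cancel_right]
    refine (hb (k + 1)).trans ?_
    have h2 : ρ⁻¹ ^ (k + 1) ≤ ρ⁻¹ ^ k :=
      pow_le_pow_of_le_one (by positivity) hr1.le (Nat.le_succ k)
    rw [mul_assoc]
    gcongr
    exact (le_max_right _ _).trans (le_max_right _ _)

end Gamma

theorem isSchur_of_injective {ι κ : Type} {c : ℤ → ℂ} (hc : Summable fun k => ‖c k‖)
    (φ : ι → κ → ℤ) (h₁ : ∀ i, Function.Injective (φ i)) (h₂ : ∀ j, Function.Injective fun i => φ i j) :
    IsSchur fun i j => c (φ i j) :=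
  ⟨_, tsum_enorm_ne_top_iff_summable_norm.2 hc,
    fun i => ENNReal.tsum_comp_le_tsum_of_injective (h₁ i) fun k => ‖c k‖ₑ,
    fun j => ENNReal.tsum_comp_le_tsum_of_injective (h₂ j) fun k => ‖c k‖ₑ⟩

theorem circleCoeff_congr {f g : ℂ → ℂ} (h : ∀ z, ‖z‖ = 1 → f z = g z) (k : ℤ) :
    circleCoeff f k = circleCoeff g k := by
  rw [circleCoeff, circleCoeff]
  simp only [h _ (Complex.norm_exp_ofReal_mul_I _)]

/-- The lower triangular Toeplitz matrix with symbol `γ(·,t)`. -/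
def toepL (t : ℕ → ℂ) : ℕ → ℕ → ℂ := fun i j => hcoef t (i - j)

/-- The upper triangular Toeplitz matrix with symbol `γ(·,t)`. -/
def toepU (t : ℕ → ℂ) : ℕ → ℕ → ℂ := fun i j => hcoef t (j - i)

/-- The Hankel matrix of the coefficients of `γ(·,t)`, with columns indexed by `ℤ`. -/
def hankZ (t : ℕ → ℂ) : ℕ → ℤ → ℂ := fun i s => hcoef t (s + i + 1)

/-- The Hankel matrix of the coefficients of `γ(·,t)`. -/
def hankN (t : ℕ → ℂ) : ℕ → ℕ → ℂ := fun i s => hcoef t (s + i + 1)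

section Toeplitz

variable {R : ℝ} {t t' s : ℕ → ℂ}

theorem summable_norm_hcoef (hR : 1 < R) (ht : RSummable R t) : Summable fun k => ‖hcoef t k‖ :=
  (isLaurent_gammaFn hR ht).1.summable

theorem isSchur_toepL (hR : 1 < R) (ht : RSummable R t) : IsSchur (toepL t) :=
  isSchur_of_injective (summable_norm_hcoef hR ht) (fun i j : ℕ => (i - j : ℤ))
    (fun i j j' h => by simp only at h; omega) fun j i i' h => by simp only at h; omega

theorem isSchur_toepU (hR : 1 < R) (ht : RSummable R t) : IsSchur (toepU t) :=
  (isSchur_toepL hR ht).transpose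

theorem isSchur_hankZ (hR : 1 < R) (ht : RSummable R t) : IsSchur (hankZ t) :=
  isSchur_of_injective (summable_norm_hcoef hR ht) (fun (i : ℕ) (s : ℤ) => s + i + 1)
    (fun i j j' h => by simp only at h; omega) fun j i i' h => by simp only at h; omega

theorem isSchur_hankN (hR : 1 < R) (ht : RSummable R t) : IsSchur (hankN t) :=
  isSchur_of_injective (summable_norm_hcoef hR ht) (fun (i s : ℕ) => (s + i + 1 : ℤ))
    (fun i j j' h => by simp only at h; omega) fun j i i' h => by simp only at h; omega

theorem hcoef_add (hR : 1 < R) (ht : RSummable R t) (hs : RSummable R s) (m : ℤ) :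
    hcoef (t + s) m = ∑' l, hcoef t (m - l) * hcoef s l := by
  rw [← (isLaurent_gammaFn hR ht).1.circleCoeff_mul (isLaurent_gammaFn hR hs).1,
    ← (isLaurent_gammaFn hR (ht.add (by linarith) hs)).1.circleCoeff_eq]
  exact circleCoeff_congr (fun z hz => gammaFn_add ht hs (hz.trans_le hR.le)) m

theorem Jcoef_eq_tsum (hR : 1 < R) (ht : RSummable R t) (ht' : RSummable R t') (m : ℤ) :
    Jcoef t t' m = ∑' l, hcoef t (m + l) * hcoef (-t') l := by
  have h := (isLaurent_gammaFn hR ht).1.circleCoeff_mul (isLaurent_gammaFn hR ht'.neg).1.inv m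
  rw [← (Equiv.neg ℤ).tsum_eq] at h
  simp only [Equiv.neg_apply, sub_neg_eq_add, neg_neg] at h
  rw [← h]
  refine circleCoeff_congr (f := fun z => Jfun z t t') (fun z hz => ?_) m
  have hz' : ‖z⁻¹‖ ≤ R := by rw [norm_inv, hz, inv_one]; exact hR.le
  rw [Jfun, gammaFn, gammaFn, ← Complex.exp_add,
    ← (ht.summable_mul_pow (hz.trans_le hR.le)).of_norm.tsum_add
      (ht'.neg.summable_mul_pow hz').of_norm]
  simp [sub_eq_add_neg]

theorem tsum_int_eq_tsum_nat {f : ℤ → ℂ} (hf : ∀ k < 0, f k = 0) :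
    ∑' k, f k = ∑' k : ℕ, f k := by
  rw [← (Nat.cast_injective (R := ℤ)).tsum_eq]
  intro k hk
  have : 0 ≤ k := by
    by_contra h
    exact hk (hf k (not_le.1 h))
  exact ⟨k.toNat, by simp [this]⟩

theorem infMul_toepL (hR : 1 < R) (ht : RSummable R t) (hs : RSummable R s) :
    infMul (toepL t) (toepL s) = toepL (t + s) := by
  ext i j
  rw [toepL, hcoef_add hR ht hs, ← (Equiv.subRight (j : ℤ)).tsum_eq, tsum_int_eq_tsum_nat]
  · refine tsum_congr fun p => ?_
    simp [toepL]
  · intro k hk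
    rw [Equiv.subRight_apply, hcoef_of_neg (t := s) (by omega), mul_zero]

theorem toepU_eq_transpose (t : ℕ → ℂ) : toepU t = fun i j => toepL t j i := rfl

theorem infMul_toepU (hR : 1 < R) (ht : RSummable R t) (hs : RSummable R s) :
    infMul (toepU t) (toepU s) = toepU (t + s) := by
  rw [toepU_eq_transpose (t + s), add_comm, ← infMul_toepL hR hs ht]
  exact (infMul_transpose (toepL s) (toepL t)).symm

theorem hcoef_zero_left (hR : 1 < R) (k : ℤ) : hcoef 0 k = if k = 0 then 1 else 0 := by
  have h0 : RSummable R 0 := by simp [RSummable, summable_zero]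
  have h := isLaurent_linCoeff hR h0 0
  have h1 := (isLaurent_gammaFn hR h0).1
  have h2 : (fun z => gammaFn z 0) = fun z : ℂ => 1 + 0 * ∑' n, (0 : ℕ → ℂ) n * z ^ (n + 1) := by
    ext z
    simp [gammaFn]
  rw [h2] at h1
  rw [h1.ext h]
  match k with
  | Int.ofNat 0 => rfl
  | Int.ofNat (k + 1) => simp only [linCoeff]; rw [if_neg (by simp; omega), zero_mul]
  | Int.negSucc k => rw [if_neg (by simp)]; rfl

theorem toepL_zero (hR : 1 < R) : toepL 0 = fun i j => if i = j then 1 else 0 := by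
  ext i j
  rw [toepL, hcoef_zero_left hR]
  congr 1
  simp [sub_eq_zero]

theorem toepU_zero (hR : 1 < R) : toepU 0 = fun i j => if i = j then 1 else 0 := by
  rw [toepU_eq_transpose, toepL_zero hR]
  simp only [eq_comm]

theorem summable_hcoef_mul_hcoef (hR : 1 < R) (ht : RSummable R t) (ht' : RSummable R t')
    (a b : ℤ) : Summable fun k : ℤ => hcoef t (k + a) * hcoef t' (k + b) := by
  have h := (isSchur_of_injective (summable_norm_hcoef hR ht) (fun a k : ℤ => k + a)
    (fun i j j' h => by simp only at h; omega) fun j i i' h => by simp only at h; omega).summable_mul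
    (isSchur_of_injective (summable_norm_hcoef hR ht') (fun k a : ℤ => k + a)
    (fun i j j' h => by simp only at h; omega) fun j i i' h => by simp only at h; omega) a b
  exact h

theorem infMul_toepU_toepL_apply (t t' : ℕ → ℂ) (i j : ℕ) :
    infMul (toepU t') (toepL t) i j =
      ∑' s : ℤ, hcoef t (s + (i + 1)) * hcoef t' (s + (j + 1)) := by
  rw [← (Equiv.subRight (i + j + 1 : ℤ)).tsum_eq, tsum_int_eq_tsum_nat]
  · refine tsum_congr fun p => ?_
    rw [Equiv.subRight_apply, toepU, toepL, mul_comm]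
    congr 2 <;> ring
  · intro k hk
    rw [Equiv.subRight_apply, hcoef_of_neg (t := t) (by omega), zero_mul]

theorem infMul_toepU_toepL (hR : 1 < R) (ht : RSummable R t) (ht' : RSummable R t') :
    infMul (toepU t') (toepL t) = infMul (toepL t) (toepU t') +
      infMul (hankN t) fun s j => hankN t' j s := by
  ext i j
  have hs := summable_hcoef_mul_hcoef hR ht ht' (i + 1) (j + 1)
  have hs₁ := hs.comp_injective (Nat.cast_injective (R := ℤ))
  have hs₂ := hs.comp_injective (i := fun n : ℕ => -(n + 1 : ℤ)) fun a b h => by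
    simp only at h
    omega
  have h2 := tsum_of_nat_of_neg_add_one
    (f := fun s : ℤ => hcoef t (s + (i + 1)) * hcoef t' (s + (j + 1))) hs₁ hs₂
  refine ((infMul_toepU_toepL_apply t t' i j).trans h2).trans ?_
  rw [Pi.add_apply, Pi.add_apply, add_comm]
  congr 1
  refine tsum_congr fun p => ?_
  rw [toepL, toepU]
  congr 2 <;> ring

end Toeplitz

theorem tendsto_one_add_pow_exp {x : ℕ → ℂ} {p : ℕ → ℕ} {z : ℂ} (hp : Tendsto p atTop atTop)
    (h : Tendsto (fun m => (p m : ℂ) * x m) atTop (𝓝 z)) :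
    Tendsto (fun m => (1 + x m) ^ p m) atTop (𝓝 (Complex.exp z)) := by
  have hpinv : Tendsto (fun m => ((p m : ℂ))⁻¹) atTop (𝓝 0) :=
    (tendsto_inv_atTop_nhds_zero_nat (𝕜 := ℂ)).comp hp
  have hx : Tendsto x atTop (𝓝 0) := by
    have := hpinv.mul h
    rw [zero_mul] at this
    refine this.congr' ?_
    filter_upwards [hp.eventually_gt_atTop 0] with m hm
    have : (p m : ℂ) ≠ 0 := by exact_mod_cast hm.ne'
    field_simp
  have hlog : (fun m => Complex.log (1 + x m) - x m) =o[atTop] x := by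
    have hd := (Complex.hasDerivAt_log Complex.one_mem_slitPlane).isLittleO
    have h1 : Tendsto (fun m => 1 + x m) atTop (𝓝 1) := by simpa using hx.const_add 1
    have h2 := hd.comp_tendsto h1
    refine (h2.congr ?_ ?_)
    · intro m
      simp
    · intro m
      simp
  have hmul : Tendsto (fun m => (p m : ℂ) * (Complex.log (1 + x m) - x m)) atTop (𝓝 0) := by
    have h1 : (fun m => (p m : ℂ) * (Complex.log (1 + x m) - x m)) =o[atTop]
        fun m => (p m : ℂ) * x m := (Asymptotics.isBigO_refl _ _).mul_isLittleO hlog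
    exact (Asymptotics.isLittleO_one_iff ℂ).1 (h1.trans_isBigO (h.isBigO_one ℂ))
  have hfin := (Complex.continuous_exp.tendsto _).comp (hmul.add h)
  rw [zero_add] at hfin
  refine hfin.congr' ?_
  filter_upwards [hx.eventually_ne (show (0 : ℂ) ≠ -1 by simp)] with m hm
  have hne : 1 + x m ≠ 0 := fun h0 => hm (by linear_combination h0)
  rw [Function.comp_apply, ← mul_add, sub_add_cancel, Complex.exp_nat_mul, Complex.exp_log hne]

/-- The Fredholm determinant of a small perturbation is, to first order, one plus the trace. -/
theorem tendsto_mul_fredDet_sub_one {Q : ℕ → ℕ → ℕ → ℂ} {K W : ℕ → ℕ → ℂ} {p : ℕ → ℕ}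
    (hp : Tendsto p atTop atTop) (hp1 : ∀ m, 1 ≤ p m)
    (h : DomTendsto (fun m i j => (p m : ℂ) * Q m i j) K W) (hW : IsEntrySummable W) :
    Tendsto (fun m => (p m : ℂ) * (fredDet (Q m) - 1)) atTop (𝓝 (∑' i, K i i)) := by
  have hp0 : ∀ m, (p m : ℂ) ≠ 0 := fun m => by exact_mod_cast (by have := hp1 m; omega)
  have hp1' : ∀ m, (1 : ℝ) ≤ p m := fun m => by exact_mod_cast hp1 m
  have hQW : ∀ m i j, ‖Q m i j‖ ≤ ‖W i j‖ := fun m i j => by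
    refine le_trans ?_ (h.bound m i j)
    rw [norm_mul, Complex.norm_natCast]
    exact le_mul_of_one_le_left (norm_nonneg _) (hp1' m)
  let F : ℕ → Finset ℕ → ℂ := fun m s =>
    if s = ∅ then 0 else (p m : ℂ) * ((p m : ℂ)⁻¹) ^ s.card *
      (Matrix.of fun i j : s => (p m : ℂ) * Q m i j).det
  have hminor : ∀ m (s : Finset ℕ), (Matrix.of fun i j : s => Q m i j).det =
      ((p m : ℂ)⁻¹) ^ s.card * (Matrix.of fun i j : s => (p m : ℂ) * Q m i j).det := by
    intro m s
    have : (Matrix.of fun i j : s => (p m : ℂ) * Q m i j) =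
        (p m : ℂ) • Matrix.of fun i j : s => Q m i j := rfl
    rw [this, Matrix.det_smul, Fintype.card_coe, ← mul_assoc, ← mul_pow,
      inv_mul_cancel₀ (hp0 m), one_pow, one_mul]
  have hF : ∀ m, (p m : ℂ) * (fredDet (Q m) - 1) = ∑' s, F m s := by
    intro m
    have hs := (hW.mono (hQW m)).summable_minors.of_norm
    have h1 : (1 : ℂ) = ∑' s : Finset ℕ, if s = ∅ then 1 else 0 := by simp
    rw [fredDet, h1, ← hs.tsum_sub (hasSum_ite_eq (∅ : Finset ℕ) (1 : ℂ)).summable, ← tsum_mul_left]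
    refine tsum_congr fun s => ?_
    by_cases hse : s = ∅
    · subst hse
      simp [F]
    · simp only [F, if_neg hse, sub_zero]
      rw [hminor, mul_assoc]
  have hK : ∑' i, K i i =
      ∑' s : Finset ℕ, if s.card = 1 then (Matrix.of fun i j : s => K i j).det else 0 := by
    have hinj : Function.Injective (fun i : ℕ => ({i} : Finset ℕ)) := Finset.singleton_injective
    rw [← hinj.tsum_eq]
    · refine tsum_congr fun i => ?_
      rw [if_pos (Finset.card_singleton i)]
      exact (Matrix.det_eq_elem_of_card_eq_one
        (A := Matrix.of fun j k : ({i} : Finset ℕ) => K j k) (by simp) ⟨i, by simp⟩).symm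
    · intro s hs
      have : s.card = 1 := by
        by_contra hne
        exact hs (if_neg hne)
      obtain ⟨i, rfl⟩ := Finset.card_eq_one.1 this
      exact ⟨i, rfl⟩
  rw [hK]
  simp only [hF]
  refine tendsto_tsum_of_dominated_convergence hW.summable_prod_rowSum (fun s => ?_)
    (Eventually.of_forall fun m s => ?_)
  · have hpinv : Tendsto (fun m => ((p m : ℂ))⁻¹) atTop (𝓝 0) :=
      (tendsto_inv_atTop_nhds_zero_nat (𝕜 := ℂ)).comp hp
    rcases s.eq_empty_or_nonempty with rfl | hs
    · simp [F]
    · obtain ⟨c, hc⟩ : ∃ c, s.card = c + 1 := ⟨s.card - 1, by have := hs.card_pos; omega⟩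
      have hF' : ∀ m, F m s = ((p m : ℂ)⁻¹) ^ c *
          (Matrix.of fun i j : s => (p m : ℂ) * Q m i j).det := fun m => by
        simp only [F, if_neg hs.ne_empty, hc, pow_succ']
        rw [← mul_assoc, mul_inv_cancel₀ (hp0 m), one_mul]
      simp only [hF']
      have hlim := (hpinv.pow c).mul (h.minor s)
      by_cases h0 : c = 0
      · subst h0
        rw [if_pos (by omega)]
        simpa using hlim
      · rw [if_neg (by omega)]
        simpa [h0] using hlim
  · by_cases hse : s = ∅
    · simp only [F, if_pos hse, norm_zero]
      exact Finset.prod_nonneg fun i _ => tsum_nonneg fun j => norm_nonneg _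
    · simp only [F, if_neg hse]
      refine le_trans ?_ (norm_minor_le hW (h.bound m) s)
      rw [norm_mul]
      refine mul_le_of_le_one_left (norm_nonneg _) ?_
      obtain ⟨c, hc⟩ : ∃ c, s.card = c + 1 :=
        ⟨s.card - 1, by have := (Finset.nonempty_iff_ne_empty.2 hse).card_pos; omega⟩
      rw [hc, pow_succ', ← mul_assoc, mul_inv_cancel₀ (hp0 m), one_mul, norm_pow, norm_inv,
        Complex.norm_natCast]
      exact pow_le_one₀ (by positivity) (inv_le_one_of_one_le₀ (hp1' m))

theorem isEntrySummable_of_norm_le_geometric {A : ℕ → ℕ → ℂ} {C r : ℝ} (hr : 0 < r) (hr1 : r < 1)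
    (h : ∀ i j, ‖A i j‖ ≤ C * r ^ (j + i)) : IsEntrySummable A := by
  have hg := summable_geometric_of_lt_one hr.le hr1
  have hs : Summable fun p : ℕ × ℕ => ‖A p.1 p.2‖ := by
    refine Summable.of_nonneg_of_le (fun _ => norm_nonneg _) (fun p => h p.1 p.2) ?_
    refine ((hg.mul_of_nonneg hg (fun _ => by positivity) fun _ => by positivity).mul_left C).congr
      fun p => ?_
    ring
  have := tsum_enorm_ne_top_iff_summable_norm.2 hs
  rwa [ENNReal.tsum_prod'] at this

section Szego

variable {R : ℝ} {t t' s : ℕ → ℂ}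

theorem isEntrySummable_hankN (hR : 1 < R) (ht : RSummable R t) : IsEntrySummable (hankN t) := by
  obtain ⟨r, C, hr, hr1, h⟩ := exists_hcoef_bounds hR ht
  have hC : 0 ≤ C := by
    have := (norm_nonneg _).trans (h 1 (by simp) 0).1
    simpa using this
  refine isEntrySummable_of_norm_le_geometric (C := C) hr hr1 fun i s => ?_
  have h1 := (h 1 (by simp) (s + i + 1)).1
  rw [one_smul] at h1
  refine le_trans (le_of_eq ?_) (h1.trans ?_)
  · rw [hankN]
    push_cast
    rfl
  · exact mul_le_mul_of_nonneg_left (pow_le_pow_of_le_one hr.le hr1.le (Nat.le_succ _)) hC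

theorem norm_inv_natCast_add_one_le (m : ℕ) : ‖((m : ℂ) + 1)⁻¹‖ ≤ 1 := by
  rw [norm_inv]
  have : ‖(m : ℂ) + 1‖ = m + 1 := by exact_mod_cast Complex.norm_natCast (m + 1)
  rw [this]
  exact inv_le_one_of_one_le₀ (by linarith [m.cast_nonneg (α := ℝ)])

theorem tendsto_inv_natCast_add_one : Tendsto (fun m : ℕ => ((m : ℂ) + 1)⁻¹) atTop (𝓝 0) := by
  have := (tendsto_add_atTop_iff_nat 1).2 (tendsto_inv_atTop_nhds_zero_nat (𝕜 := ℂ))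
  simpa using this

theorem tendsto_hcoef_smul (hR : 1 < R) (ht : RSummable R t) {c : ℕ → ℂ} (hc : ∀ m, ‖c m‖ ≤ 1)
    (hc0 : Tendsto c atTop (𝓝 0)) (k : ℤ) :
    Tendsto (fun m => hcoef (c m • t) k) atTop (𝓝 (if k = 0 then 1 else 0)) := by
  match k with
  | Int.ofNat 0 =>
    have h1 : ∀ m, hcoef (c m • t) (Int.ofNat 0) = 1 := fun m => hcoef_zero hR (ht.smul _)
    simp only [h1]
    exact tendsto_const_nhds
  | Int.ofNat (k + 1) =>
    rw [if_neg (by simp; omega)]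
    obtain ⟨r, C, hr, hr1, h⟩ := exists_hcoef_bounds hR ht
    have h1 : Tendsto (fun m => ‖c m‖ ^ 2 * (C * r ^ k)) atTop (𝓝 0) := by
      simpa using (hc0.norm.pow 2).mul_const (C * r ^ k)
    have h2 := squeeze_zero_norm (fun m => (h (c m) (hc m) k).2.2) h1
    have h3 := h2.add (hc0.mul_const (t k))
    simp only [sub_add_cancel, zero_mul, add_zero] at h3
    exact h3
  | Int.negSucc k =>
    have h1 : ∀ m, hcoef (c m • t) (Int.negSucc k) = 0 := fun m =>
      hcoef_of_neg (Int.negSucc_lt_zero k)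
    simp only [h1]
    rw [if_neg (by simp)]
    exact tendsto_const_nhds

/-- A dominating sequence for the coefficients of `γ(·,ct)`, `|c| ≤ 1`. -/
theorem exists_summable_norm_hcoef_le (hR : 1 < R) (ht : RSummable R t) :
    ∃ g : ℤ → ℂ, (Summable fun k => ‖g k‖) ∧ ∀ c : ℂ, ‖c‖ ≤ 1 → ∀ k, ‖hcoef (c • t) k‖ ≤ ‖g k‖ := by
  obtain ⟨r, C, hr, hr1, h⟩ := exists_hcoef_bounds hR ht
  have hC : 0 ≤ C := by
    have := (norm_nonneg _).trans (h 1 (by simp) 0).1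
    simpa using this
  refine ⟨fun k => if k < 0 then 0 else ((C * r ^ k.toNat : ℝ) : ℂ), ?_, fun c hc k => ?_⟩
  · rw [← Nat.cast_injective.summable_iff]
    · refine ((summable_geometric_of_lt_one hr.le hr1).mul_left C).congr fun k => ?_
      have : 0 ≤ C * r ^ k := by positivity
      simp only [Function.comp_apply]
      rw [if_neg (by omega), Complex.norm_real, Int.toNat_natCast, Real.norm_of_nonneg this]
    · intro k hk
      have : k < 0 := by
        by_contra h
        exact hk ⟨k.toNat, by simp; omega⟩
      simp [this]
  · by_cases hk : k < 0
    · simp [hcoef_of_neg hk]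
    · obtain ⟨k, rfl⟩ : ∃ n : ℕ, k = n := ⟨k.toNat, by omega⟩
      have : 0 ≤ C * r ^ k := by positivity
      simp only
      rw [if_neg hk, Complex.norm_real, Int.toNat_natCast, Real.norm_of_nonneg this]
      exact (h c hc k).1

theorem exists_domTendsto_toepL (hR : 1 < R) (ht : RSummable R t) {c : ℕ → ℂ}
    (hc : ∀ m, ‖c m‖ ≤ 1) (hc0 : Tendsto c atTop (𝓝 0)) :
    ∃ W, IsSchur W ∧
      DomTendsto (fun m => toepL (c m • t)) (fun i j => if i = j then 1 else 0) W := by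
  obtain ⟨g, hg, hb⟩ := exists_summable_norm_hcoef_le hR ht
  refine ⟨fun i j => g (i - j), isSchur_of_injective hg (fun i j : ℕ => (i - j : ℤ))
    (fun i j j' h => by simp only at h; omega) (fun j i i' h => by simp only at h; omega),
    ⟨fun i j => ?_, fun m i j => hb _ (hc m) _⟩⟩
  have h := tendsto_hcoef_smul hR ht hc hc0 (i - j)
  simp only [sub_eq_zero, Nat.cast_inj] at h
  exact h

theorem DomTendsto.transpose {ι κ : Type} {A : ℕ → ι → κ → ℂ} {B W : ι → κ → ℂ}
    (h : DomTendsto A B W) :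
    DomTendsto (fun m j i => A m i j) (fun j i => B i j) fun j i => W i j :=
  ⟨fun j i => h.tendsto i j, fun m j i => h.bound m i j⟩

theorem exists_domTendsto_hankN (hR : 1 < R) (ht : RSummable R t) :
    ∃ W, IsEntrySummable W ∧
      DomTendsto (fun (m : ℕ) i s => ((m : ℂ) + 1) * hankN (((m : ℂ) + 1)⁻¹ • t) i s)
        (fun i s => t (s + i)) W := by
  obtain ⟨r, C, hr, hr1, h⟩ := exists_hcoef_bounds hR ht
  have hC : 0 ≤ C := by
    have := (norm_nonneg _).trans (h 1 (by simp) 0).1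
    simpa using this
  have hm0 : ∀ m : ℕ, (m : ℂ) + 1 ≠ 0 := fun m => by exact_mod_cast m.succ_ne_zero
  have key : ∀ m i s : ℕ, ‖((m : ℂ) + 1) * hankN (((m : ℂ) + 1)⁻¹ • t) i s - t (s + i)‖ ≤
      ‖((m : ℂ) + 1)⁻¹‖ * (C * r ^ (s + i)) := by
    intro m i s
    have h1 := (h ((m : ℂ) + 1)⁻¹ (norm_inv_natCast_add_one_le m) (s + i)).2.2
    have h2 : ((m : ℂ) + 1) * hankN (((m : ℂ) + 1)⁻¹ • t) i s - t (s + i) =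
        ((m : ℂ) + 1) * (hcoef (((m : ℂ) + 1)⁻¹ • t) ((s + i + 1 : ℕ) : ℤ) -
          ((m : ℂ) + 1)⁻¹ * t (s + i)) := by
      rw [mul_sub, mul_inv_cancel_left₀ (hm0 m), hankN]
      push_cast
      rfl
    rw [h2, norm_mul]
    refine (mul_le_mul_of_nonneg_left h1 (norm_nonneg _)).trans_eq ?_
    have h3 : ‖(m : ℂ) + 1‖ ≠ 0 := norm_ne_zero_iff.2 (hm0 m)
    rw [norm_inv]
    field_simp
  refine ⟨fun i s => ((2 * C * r ^ (s + i) : ℝ) : ℂ), ?_, fun i s => ?_, fun m i s => ?_⟩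
  · refine isEntrySummable_of_norm_le_geometric (C := 2 * C) hr hr1 fun i j => ?_
    rw [Complex.norm_real, Real.norm_of_nonneg (by positivity)]
  · have h1 : Tendsto (fun m : ℕ => ‖((m : ℂ) + 1)⁻¹‖ * (C * r ^ (s + i))) atTop (𝓝 0) := by
      simpa using tendsto_inv_natCast_add_one.norm.mul_const (C * r ^ (s + i))
    exact tendsto_sub_nhds_zero_iff.1 (squeeze_zero_norm (fun m => key m i s) h1)
  · rw [Complex.norm_real, Real.norm_of_nonneg (by positivity)]
    have h1 := key m i s
    have h2 := (h 1 (by simp) (s + i)).2.1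
    have h3 : ‖((m : ℂ) + 1)⁻¹‖ * (C * r ^ (s + i)) ≤ C * r ^ (s + i) :=
      mul_le_of_le_one_left (by positivity) (norm_inv_natCast_add_one_le m)
    have h4 := norm_le_norm_sub_add (((m : ℂ) + 1) * hankN (((m : ℂ) + 1)⁻¹ • t) i s) (t (s + i))
    linarith

/-- The difference from the identity of the multiplicative commutator of the Toeplitz matrices
of `γ(·,t)` and `γ(·,t')`. -/
def commPert (t t' : ℕ → ℂ) : ℕ → ℕ → ℂ :=
  infMul (toepL (-t)) (infMul (infMul (hankN t) fun s j => hankN t' j s) (toepU (-t')))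

theorem isEntrySummable_commPert (hR : 1 < R) (ht : RSummable R t) (ht' : RSummable R t') :
    IsEntrySummable (commPert t t') :=
  IsEntrySummable.infMul_left (isSchur_toepL hR ht.neg)
    (((isEntrySummable_hankN hR ht).infMul_right (isSchur_hankN hR ht').transpose).infMul_right
      (isSchur_toepU hR ht'.neg))

/-- `toepL t` as an element of the ring `schurRing`. -/
def lowR (hR : 1 < R) (ht : RSummable R t) : schurRing := ⟨toepL t, isSchur_toepL hR ht⟩

/-- `toepU t` as an element of the ring `schurRing`. -/
def upR (hR : 1 < R) (ht : RSummable R t) : schurRing := ⟨toepU t, isSchur_toepU hR ht⟩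

theorem lowR_neg_mul (hR : 1 < R) (ht : RSummable R t) (ht₁ : RSummable R (-t)) :
    lowR hR ht₁ * lowR hR ht = 1 := by
  refine Subtype.ext ((infMul_toepL hR ht₁ ht).trans ?_)
  rw [neg_add_cancel, toepL_zero hR]
  rfl

theorem lowR_mul_neg (hR : 1 < R) (ht : RSummable R t) (ht₁ : RSummable R (-t)) :
    lowR hR ht * lowR hR ht₁ = 1 := by
  refine Subtype.ext ((infMul_toepL hR ht ht₁).trans ?_)
  rw [add_neg_cancel, toepL_zero hR]
  rfl

theorem upR_neg_mul (hR : 1 < R) (ht : RSummable R t) (ht₁ : RSummable R (-t)) :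
    upR hR ht₁ * upR hR ht = 1 := by
  refine Subtype.ext ((infMul_toepU hR ht₁ ht).trans ?_)
  rw [neg_add_cancel, toepU_zero hR]
  rfl

theorem upR_mul_neg (hR : 1 < R) (ht : RSummable R t) (ht₁ : RSummable R (-t)) :
    upR hR ht * upR hR ht₁ = 1 := by
  refine Subtype.ext ((infMul_toepU hR ht ht₁).trans ?_)
  rw [add_neg_cancel, toepU_zero hR]
  rfl

theorem commPert_eq (hR : 1 < R) (ht : RSummable R t) (ht' : RSummable R t') :
    commPert t t' = (lowR hR ht.neg * upR hR ht' * lowR hR ht * upR hR ht'.neg - 1).1 := by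
  let H : schurRing := ⟨infMul (hankN t) fun s j => hankN t' j s,
    (isSchur_hankN hR ht).infMul (isSchur_hankN hR ht').transpose⟩
  have hcomm : upR hR ht' * lowR hR ht = lowR hR ht * upR hR ht' + H :=
    Subtype.ext (infMul_toepU_toepL hR ht ht')
  have : lowR hR ht.neg * upR hR ht' * lowR hR ht * upR hR ht'.neg - 1 =
      lowR hR ht.neg * (H * upR hR ht'.neg) := by
    rw [mul_assoc (lowR hR ht.neg), hcomm, mul_add, ← mul_assoc, lowR_neg_mul, one_mul, add_mul,
      upR_mul_neg, mul_assoc]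
    abel
  rw [this]
  rfl

theorem fredDet_schurRing_mul {A B : schurRing} (hA : IsEntrySummable (A - 1).1)
    (hB : IsEntrySummable (B - 1).1) :
    fredDet (A * B - 1).1 = fredDet (A - 1).1 * fredDet (B - 1).1 := by
  rw [← fredDet_mul hA hB]
  have : A * B - 1 = (A - 1) + (B - 1) + (A - 1) * (B - 1) := by noncomm_ring
  rw [this]
  rfl

theorem fredDet_schurRing_comm {A B : schurRing} (hA : IsEntrySummable A.1) :
    fredDet (A * B).1 = fredDet (B * A).1 :=
  fredDet_infMul_comm hA B.2

theorem fredDet_commPert_add_left (hR : 1 < R) (ht : RSummable R t) (hs : RSummable R s)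
    (ht' : RSummable R t') :
    fredDet (commPert (t + s) t') = fredDet (commPert s t') * fredDet (commPert t t') := by
  have hts := ht.add (by linarith) hs
  have e2 : lowR hR ht.neg * lowR hR hs.neg = lowR hR hts.neg :=
    Subtype.ext ((infMul_toepL hR ht.neg hs.neg).trans (by
      change toepL (-t + -s) = toepL (-(t + s))
      rw [neg_add]))
  have hsES := isEntrySummable_commPert hR hs ht'
  have htES := isEntrySummable_commPert hR ht ht'
  rw [commPert_eq hR hs ht'] at hsES ⊢
  rw [commPert_eq hR ht ht'] at htES ⊢
  rw [commPert_eq hR hts ht']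
  set A := lowR hR hs.neg * upR hR ht' * lowR hR hs * upR hR ht'.neg with hA
  have hconj : lowR hR ht.neg * A * lowR hR ht - 1 =
      lowR hR ht.neg * ((A - 1) * lowR hR ht) := by
    have : lowR hR ht.neg * ((A - 1) * lowR hR ht) =
        lowR hR ht.neg * A * lowR hR ht - lowR hR ht.neg * lowR hR ht := by noncomm_ring
    rw [this, lowR_neg_mul]
  have hES : IsEntrySummable ((A - 1) * lowR hR ht).1 := hsES.infMul_right (lowR hR ht).2
  have hES' : IsEntrySummable (lowR hR ht.neg * A * lowR hR ht - 1).1 := by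
    rw [hconj]
    exact IsEntrySummable.infMul_left (lowR hR ht.neg).2 hES
  have hdet : fredDet (lowR hR ht.neg * A * lowR hR ht - 1).1 = fredDet (A - 1).1 := by
    rw [hconj, ← fredDet_schurRing_comm hES, mul_assoc, lowR_mul_neg, mul_one]
  rw [← hdet, ← fredDet_schurRing_mul hES' htES]
  congr 3
  have e3 : lowR hR hs * lowR hR ht = lowR hR hts :=
    Subtype.ext ((infMul_toepL hR hs ht).trans (by rw [add_comm]; rfl))
  have e4 : ∀ X : schurRing, lowR hR ht * (lowR hR ht.neg * X) = X := fun X => by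
    rw [← mul_assoc, lowR_mul_neg, one_mul]
  have e5 : ∀ X : schurRing, upR hR ht'.neg * (upR hR ht' * X) = X := fun X => by
    rw [← mul_assoc, upR_neg_mul, one_mul]
  rw [hA, ← e2, ← e3]
  simp only [mul_assoc, e4, e5]

end Szego

theorem const_mul_infMul {ι κ μ : Type} (c : ℂ) (A : ι → κ → ℂ) (B : κ → μ → ℂ) :
    infMul (fun i j => c * A i j) B = fun i k => c * infMul A B i k := by
  ext i k
  simp only [infMul, mul_assoc, tsum_mul_left]

theorem infMul_const_mul {ι κ μ : Type} (c : ℂ) (A : ι → κ → ℂ) (B : κ → μ → ℂ) :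
    infMul A (fun j k => c * B j k) = fun i k => c * infMul A B i k := by
  ext i k
  simp only [infMul, mul_left_comm _ c, tsum_mul_left]

theorem one_infMul {ι κ : Type} [DecidableEq ι] (A : ι → κ → ℂ) :
    infMul (fun i j : ι => if i = j then 1 else 0) A = A := by
  ext i k
  simp [infMul]

theorem infMul_one {ι κ : Type} [DecidableEq κ] (A : ι → κ → ℂ) :
    infMul A (fun i j : κ => if i = j then 1 else 0) = A := by
  ext i k
  simp [infMul]

section Szego

variable {R : ℝ} {t t' s : ℕ → ℂ}

theorem fredDet_commPert_comm (hR : 1 < R) (ht : RSummable R t) (ht' : RSummable R t') :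
    fredDet (commPert t t') = fredDet (commPert t' t) := by
  rw [← fredDet_transpose]
  congr 1
  unfold commPert
  rw [infMul_transpose, infMul_transpose, infMul_transpose]
  exact infMul_assoc (isSchur_toepL hR ht'.neg)
    ((isSchur_hankN hR ht').infMul (isSchur_hankN hR ht).transpose) (isSchur_toepU hR ht.neg)

theorem fredDet_commPert_natCast_smul_left (hR : 1 < R) (ht : RSummable R t)
    (ht' : RSummable R t') (m : ℕ) :
    fredDet (commPert (((m : ℂ) + 1) • t) t') = fredDet (commPert t t') ^ (m + 1) := by
  induction m with
  | zero => simp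
  | succ m ih =>
    rw [pow_succ, ← ih, Nat.cast_succ, add_smul ((m : ℂ) + 1), one_smul, add_comm,
      fredDet_commPert_add_left hR ht (ht.smul _) ht']

theorem fredDet_commPert_eq_pow (hR : 1 < R) (ht : RSummable R t) (ht' : RSummable R t') (m : ℕ) :
    fredDet (commPert t t') =
      fredDet (commPert (((m : ℂ) + 1)⁻¹ • t) (((m : ℂ) + 1)⁻¹ • t')) ^ (m + 1) ^ 2 := by
  have hm0 : (m : ℂ) + 1 ≠ 0 := by exact_mod_cast m.succ_ne_zero
  have ht₁ : RSummable R (((m : ℂ) + 1)⁻¹ • t) := ht.smul _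
  have ht₁' : RSummable R (((m : ℂ) + 1)⁻¹ • t') := ht'.smul _
  rw [pow_two, pow_mul, ← fredDet_commPert_natCast_smul_left hR ht₁ ht₁', smul_inv_smul₀ hm0,
    fredDet_commPert_comm hR ht ht₁', ← fredDet_commPert_natCast_smul_left hR ht₁' ht,
    smul_inv_smul₀ hm0, fredDet_commPert_comm hR ht' ht]

theorem tsum_tsum_add_mul_add (hR : 1 < R) (ht : RSummable R t) (ht' : RSummable R t') :
    ∑' i : ℕ, ∑' s : ℕ, t (s + i) * t' (s + i) = ∑' n : ℕ, (n + 1 : ℂ) * t n * t' n := by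
  obtain ⟨r, C, hr, hr1, h⟩ := exists_hcoef_bounds hR ht
  obtain ⟨r', C', hr', hr1', h'⟩ := exists_hcoef_bounds hR ht'
  have hg := summable_geometric_of_lt_one hr.le hr1
  have hb : ∀ k, ‖t k‖ ≤ C * r ^ k := fun k => (h 1 (by simp) k).2.1
  have hb' : ∀ k, ‖t' k‖ ≤ C' := fun k => ((h' 1 (by simp) k).2.1).trans
    (mul_le_of_le_one_right (by simpa using (norm_nonneg _).trans (h' 1 (by simp) 0).2.1)
      (pow_le_one₀ hr'.le hr1'.le))
  have hC : 0 ≤ C := by simpa using (norm_nonneg _).trans (hb 0)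
  have hs : Summable fun p : ℕ × ℕ => t (p.2 + p.1) * t' (p.2 + p.1) := by
    refine Summable.of_norm_bounded (g := fun p : ℕ × ℕ => C * C' * (r ^ p.1 * r ^ p.2))
      ((hg.mul_of_nonneg hg (fun _ => by positivity) fun _ => by positivity).mul_left _) fun p => ?_
    rw [norm_mul, ← pow_add, add_comm p.1]
    calc ‖t (p.2 + p.1)‖ * ‖t' (p.2 + p.1)‖ ≤ C * r ^ (p.2 + p.1) * C' :=
          mul_le_mul (hb _) (hb' _) (norm_nonneg _) (by positivity)
      _ = _ := by ring
  rw [← hs.tsum_prod (f := fun p : ℕ × ℕ => t (p.2 + p.1) * t' (p.2 + p.1)),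
    ← (Finset.HasAntidiagonal.sigmaAntidiagonalEquivProd (A := ℕ)).tsum_eq]
  have hs' := (Finset.HasAntidiagonal.sigmaAntidiagonalEquivProd.summable_iff
    (f := fun p : ℕ × ℕ => t (p.2 + p.1) * t' (p.2 + p.1))).2 hs
  refine (Summable.tsum_sigma' (fun n => (hasSum_fintype _).summable) hs').trans
    (tsum_congr fun n => ?_)
  rw [tsum_fintype, Finset.sum_congr rfl (g := fun _ => t n * t' n)]
  · simp [mul_assoc]
  · rintro ⟨⟨a, b⟩, hab⟩ -
    rw [Finset.HasAntidiagonal.mem_antidiagonal] at hab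
    change t (b + a) * t' (b + a) = _
    rw [add_comm b a, hab]

/-- The strong Szegő constant. -/
theorem fredDet_commPert (hR : 1 < R) (ht : RSummable R t) (ht' : RSummable R t') :
    fredDet (commPert t t') = Zconst t t' := by
  obtain ⟨W₁, hW₁, hL⟩ := exists_domTendsto_toepL hR ht (c := fun m => -((m : ℂ) + 1)⁻¹)
    (fun m => by rw [norm_neg]; exact norm_inv_natCast_add_one_le m)
    (by simpa using tendsto_inv_natCast_add_one.neg)
  obtain ⟨W₂, hW₂, hU⟩ := exists_domTendsto_toepL hR ht' (c := fun m => -((m : ℂ) + 1)⁻¹)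
    (fun m => by rw [norm_neg]; exact norm_inv_natCast_add_one_le m)
    (by simpa using tendsto_inv_natCast_add_one.neg)
  obtain ⟨V₁, hV₁, hH⟩ := exists_domTendsto_hankN hR ht
  obtain ⟨V₂, hV₂, hH'⟩ := exists_domTendsto_hankN hR ht'
  have hHH := hH.infMul hH'.transpose hV₁.isSchur hV₂.transpose.isSchur
  have hV₃ := hV₁.normMatrix.infMul_right hV₂.transpose.isSchur.normMatrix
  have hHU := hHH.infMul hU.transpose hV₃.isSchur hW₂.transpose
  have hV₄ := hV₃.normMatrix.infMul_right hW₂.transpose.normMatrix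
  have hK := hL.infMul hHU hW₁ hV₄.isSchur
  have hV₅ := hV₄.normMatrix.infMul_left hW₁.normMatrix
  rw [one_infMul] at hK
  have hδ : (fun j i : ℕ => if i = j then (1 : ℂ) else 0) = fun i j => if i = j then 1 else 0 := by
    ext i j
    simp only [eq_comm]
  rw [hδ, infMul_one] at hK
  have hp : Tendsto (fun m : ℕ => (m + 1) ^ 2) atTop atTop :=
    (tendsto_pow_atTop two_ne_zero).comp (tendsto_add_atTop_nat 1)
  have hKeq : (fun (m : ℕ) (i j : ℕ) => (((m + 1) ^ 2 : ℕ) : ℂ) *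
      commPert (((m : ℂ) + 1)⁻¹ • t) (((m : ℂ) + 1)⁻¹ • t') i j) = fun m : ℕ =>
      infMul (toepL (-((m : ℂ) + 1)⁻¹ • t))
        (infMul (infMul (fun i s => ((m : ℂ) + 1) * hankN (((m : ℂ) + 1)⁻¹ • t) i s)
          fun j i => ((m : ℂ) + 1) * hankN (((m : ℂ) + 1)⁻¹ • t') i j)
          fun j i => toepL (-((m : ℂ) + 1)⁻¹ • t') i j) := by
    ext m i j
    have h1 := infMul_const_mul ((m : ℂ) + 1) (hankN (((m : ℂ) + 1)⁻¹ • t))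
      fun s j => hankN (((m : ℂ) + 1)⁻¹ • t') j s
    rw [const_mul_infMul, h1, const_mul_infMul, const_mul_infMul, infMul_const_mul,
      infMul_const_mul, commPert, neg_smul, neg_smul, toepU_eq_transpose, pow_two]
    push_cast
    exact mul_assoc _ _ _
  have hlim := tendsto_mul_fredDet_sub_one
    (Q := fun m : ℕ => commPert (((m : ℂ) + 1)⁻¹ • t) (((m : ℂ) + 1)⁻¹ • t')) hp
    (fun m => Nat.one_le_pow _ _ m.succ_pos) (by rw [hKeq]; exact hK) hV₅
  have hexp := tendsto_one_add_pow_exp hp hlim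
  simp only [add_sub_cancel, ← fredDet_commPert_eq_pow hR ht ht'] at hexp
  rw [tendsto_nhds_unique tendsto_const_nhds hexp, Zconst, ← tsum_tsum_add_mul_add hR ht ht']
  rfl

end Szego

/-- The matrix `∑_{s ∈ ℤ} w_s h_{s+i+1}(t) h_{s+j+1}(t')`. -/
def weightedGram (w : ℤ → ℂ) (t t' : ℕ → ℂ) : ℕ → ℕ → ℂ :=
  infMul (fun i s => w s * hankZ t i s) fun s j => hankZ t' j s

section Kernel

variable {R : ℝ} {t t' : ℕ → ℂ} {w : ℤ → ℂ}

theorem isEntrySummable_weighted_hankZ (hR : 1 < R) (ht : RSummable R t) (hw1 : ∀ s, ‖w s‖ ≤ 1)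
    (hw : Summable fun m : ℕ => ‖w (-(m + 1))‖) :
    IsEntrySummable fun i s => w s * hankZ t i s := by
  obtain ⟨M, hM, -, hcol⟩ := isSchur_hankZ hR ht
  have hN := (isEntrySummable_hankN hR ht).transpose
  rw [IsEntrySummable, ENNReal.tsum_comm, tsum_of_nat_of_neg_add_one
    (f := fun s : ℤ => ∑' i, ‖w s * hankZ t i s‖ₑ) ENNReal.summable ENNReal.summable]
  refine ENNReal.add_ne_top.2 ⟨ne_top_of_le_ne_top hN ?_, ne_top_of_le_ne_top
    (ENNReal.mul_ne_top (tsum_enorm_ne_top_iff_summable_norm.2 hw) hM) ?_⟩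
  · refine ENNReal.tsum_le_tsum fun s => ENNReal.tsum_le_tsum fun i => ?_
    rw [enorm_mul]
    refine mul_le_of_le_one_left zero_le ?_
    rw [← ofReal_norm]
    exact ENNReal.ofReal_le_one.2 (hw1 _)
  · rw [← ENNReal.tsum_mul_right]
    refine ENNReal.tsum_le_tsum fun m => ?_
    simp only [enorm_mul, ENNReal.tsum_mul_left]
    gcongr
    exact hcol _

theorem isEntrySummable_weightedGram (hR : 1 < R) (ht : RSummable R t) (ht' : RSummable R t')
    (hw1 : ∀ s, ‖w s‖ ≤ 1) (hw : Summable fun m : ℕ => ‖w (-(m + 1))‖) :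
    IsEntrySummable (weightedGram w t t') :=
  (isEntrySummable_weighted_hankZ hR ht hw1 hw).infMul_right (isSchur_hankZ hR ht').transpose

theorem infMul_toepU_hankZ_apply (hR : 1 < R) (ht : RSummable R t) (ht' : RSummable R t') (i : ℕ)
    (s : ℤ) : infMul (toepU (-t')) (hankZ t) i s = Jcoef t t' (i + s + 1) := by
  rw [Jcoef_eq_tsum hR ht ht', ← (Equiv.subRight (i : ℤ)).tsum_eq, tsum_int_eq_tsum_nat]
  · refine tsum_congr fun p => ?_
    rw [Equiv.subRight_apply, toepU, hankZ, mul_comm]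
    congr 2
    ring
  · intro k hk
    rw [Equiv.subRight_apply, hcoef_of_neg (t := -t') (by omega), mul_zero]

theorem infMul_hankZ_toepL_apply (hR : 1 < R) (ht : RSummable R t) (ht' : RSummable R t') (s : ℤ)
    (j : ℕ) :
    infMul (fun s q => hankZ t' q s) (toepL (-t)) s j = Jcoef (-t) (-t') (-(j + s + 1)) := by
  rw [Jcoef_eq_tsum hR ht.neg ht'.neg, neg_neg, ← (Equiv.addRight (s + 1)).tsum_eq,
    tsum_int_eq_tsum_nat]
  · refine tsum_congr fun p => ?_
    simp only [Equiv.coe_addRight, toepL, hankZ]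
    rw [mul_comm]
    congr 2 <;> ring
  · intro k hk
    simp only [Equiv.coe_addRight]
    rw [hcoef_of_neg (t := -t) (by omega), zero_mul]

theorem Kker_eq_infMul (hR : 1 < R) (ht : RSummable R t) (ht' : RSummable R t') {σ : ℤ → ℝ} {n : ℤ}
    (hH : IsSchur fun i s => (σ (s - n) : ℂ) * hankZ t i s) (i j : ℕ) :
    Kker t t' σ (n + i) (n + j) =
      infMul (toepU (-t')) (infMul (weightedGram (fun s => (σ (s - n) : ℂ)) t t') (toepL (-t)))
        i j := by
  have hU := isSchur_toepU hR ht'.neg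
  have hL := isSchur_toepL hR ht.neg
  have hH' := (isSchur_hankZ hR ht').transpose
  rw [weightedGram, infMul_assoc hH hH' hL, ← infMul_assoc hU hH (hH'.infMul hL), Kker,
    ← (Equiv.subRight n).tsum_eq]
  refine tsum_congr fun s => ?_
  have h1 : infMul (toepU (-t')) (fun i s => (σ (s - n) : ℂ) * hankZ t i s) i s =
      σ (s - n) * infMul (toepU (-t')) (hankZ t) i s := by
    simp only [infMul, mul_left_comm, tsum_mul_left]
  rw [h1, infMul_toepU_hankZ_apply hR ht ht', infMul_hankZ_toepL_apply hR ht ht',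
    Equiv.subRight_apply]
  congr 3 <;> ring

theorem summable_norm_neg_half {σ : ℤ → ℝ} (hσ : Summable fun k : {k : ℤ // k < 0} => σ k)
    (n : ℤ) : Summable fun m : ℕ => ‖(σ (-(m + 1) - n) : ℂ)‖ := by
  rw [← summable_nat_add_iff n.natAbs]
  have := hσ.norm.comp_injective
    (i := fun m : ℕ => (⟨-((m + n.natAbs : ℕ) + 1 : ℤ) - n, by omega⟩ : {k : ℤ // k < 0}))
    fun a b h => by
      simp only [Subtype.mk.injEq] at h
      omega
  simp only [Complex.norm_real]
  exact this

theorem weightedGram_one_sub (hR : 1 < R) (ht : RSummable R t) (ht' : RSummable R t')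
    (hw1 : ∀ s, ‖w s‖ ≤ 1) :
    weightedGram (fun s => 1 - w s) t t' =
      infMul (toepU t') (toepL t) - weightedGram w t t' := by
  ext i j
  have h1 := summable_hcoef_mul_hcoef hR ht ht' (i + 1) (j + 1)
  have h2 : Summable fun s : ℤ => w s * (hcoef t (s + (i + 1)) * hcoef t' (s + (j + 1))) :=
    h1.norm.of_norm_bounded fun s => by
      rw [norm_mul]
      exact mul_le_of_le_one_left (norm_nonneg _) (hw1 s)
  rw [Pi.sub_apply, Pi.sub_apply, infMul_toepU_toepL_apply]
  simp only [weightedGram, infMul, hankZ, add_assoc, mul_assoc]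
  rw [← h1.tsum_sub h2]
  exact tsum_congr fun s => by rw [sub_mul, one_mul]

theorem fredDet_conj_weightedGram (hR : 1 < R) (ht : RSummable R t) (ht' : RSummable R t')
    (hM : IsEntrySummable (weightedGram w t t'))
    (hF : weightedGram (fun s => 1 - w s) t t' =
      infMul (toepU t') (toepL t) - weightedGram w t t') :
    IsEntrySummable (infMul (toepL (-t)) (infMul (weightedGram (fun s => 1 - w s) t t')
        (toepU (-t'))) - fun i j => if i = j then 1 else 0) ∧
      fredDet (infMul (toepL (-t)) (infMul (weightedGram (fun s => 1 - w s) t t')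
        (toepU (-t'))) - fun i j => if i = j then 1 else 0) = Zconst t t' *
      fredDet (-infMul (toepU (-t')) (infMul (weightedGram w t t') (toepL (-t)))) := by
  have hP := isEntrySummable_commPert hR ht ht'
  have hZ := fredDet_commPert hR ht ht'
  rw [commPert_eq hR ht ht'] at hP hZ
  set A := lowR hR ht.neg with hA
  set L := lowR hR ht with hL
  set U := upR hR ht' with hU
  set V := upR hR ht'.neg with hV
  have hLA : L * A = 1 := lowR_mul_neg hR ht ht.neg
  have hAL : A * L = 1 := lowR_neg_mul hR ht ht.neg
  have hVU : V * U = 1 := upR_neg_mul hR ht' ht'.neg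
  let M : schurRing := ⟨weightedGram w t t', hM.isSchur⟩
  have e1 : infMul (toepL (-t)) (infMul (weightedGram (fun s => 1 - w s) t t') (toepU (-t'))) -
      (fun i j => if i = j then 1 else 0) = (A * ((U * L - M) * V) - 1).1 := by
    rw [hF]
    rfl
  have e2 : -infMul (toepU (-t')) (infMul (weightedGram w t t') (toepL (-t))) =
      (V * (-M * A)).1 := by
    have : V * (-M * A) = -(V * (M * A)) := by noncomm_ring
    rw [this]
    rfl
  have e3 : A * ((U * L - M) * V) = (1 - A * M * A * V * L) * (A * U * L * V) := by
    have : A * M * A * V * L * (A * U * L * V) = A * M * V := by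
      calc A * M * A * V * L * (A * U * L * V) = A * M * A * V * (L * A) * U * L * V := by
            simp only [mul_assoc]
        _ = A * M * A * (V * U) * L * V := by rw [hLA]; simp only [mul_assoc, mul_one]
        _ = A * M * (A * L) * V := by rw [hVU]; simp only [mul_assoc, mul_one]
        _ = A * M * V := by rw [hAL, mul_one]
    rw [sub_mul (1 : schurRing), this, one_mul]
    noncomm_ring
  have hMA : IsEntrySummable (-M * A).1 := hM.neg.infMul_right A.2
  have hMAVL : IsEntrySummable (-M * A * V * L).1 := (hMA.infMul_right V.2).infMul_right L.2
  have e4 : 1 - A * M * A * V * L - 1 = A * (-M * A * V * L) := by noncomm_ring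
  have hY : IsEntrySummable (1 - A * M * A * V * L - 1 : schurRing).1 := by
    rw [e4]
    exact IsEntrySummable.infMul_left A.2 hMAVL
  have e5 : A * ((U * L - M) * V) - 1 = (A * U * L * V - 1) + A * (-M * V) := by noncomm_ring
  rw [e1, e2]
  constructor
  · rw [e5]
    exact hP.add (IsEntrySummable.infMul_left A.2 (hM.neg.infMul_right V.2))
  · rw [e3, fredDet_schurRing_mul hY hP, hZ, mul_comm, e4, ← fredDet_schurRing_comm hMAVL,
      mul_assoc _ L A, hLA, mul_one, fredDet_schurRing_comm hMA]

end Kernel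

section Corner

variable {R : ℝ} {t t' : ℕ → ℂ}

theorem of_infMul_left_toepL (N : ℕ) (s : ℕ → ℂ) (F : ℕ → ℕ → ℂ) :
    (Matrix.of fun i j : Fin N => infMul (toepL s) F i j) =
      (Matrix.of fun i j : Fin N => toepL s i j) * Matrix.of fun i j : Fin N => F i j := by
  ext i j
  rw [Matrix.of_apply, Matrix.mul_apply, infMul, tsum_eq_sum (s := Finset.range N),
    Finset.sum_range]
  · rfl
  · intro p hp
    rw [Finset.mem_range] at hp
    rw [toepL, hcoef_of_neg (by omega), zero_mul]

theorem of_infMul_right_toepU (N : ℕ) (s : ℕ → ℂ) (F : ℕ → ℕ → ℂ) :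
    (Matrix.of fun i j : Fin N => infMul F (toepU s) i j) =
      (Matrix.of fun i j : Fin N => F i j) * Matrix.of fun i j : Fin N => toepU s i j := by
  ext i j
  rw [Matrix.of_apply, Matrix.mul_apply, infMul, tsum_eq_sum (s := Finset.range N),
    Finset.sum_range]
  · rfl
  · intro p hp
    rw [Finset.mem_range] at hp
    rw [toepU, hcoef_of_neg (by omega), mul_zero]

theorem det_toepL (hR : 1 < R) (ht : RSummable R t) (N : ℕ) :
    (Matrix.of fun i j : Fin N => toepL t i j).det = 1 := by
  rw [Matrix.det_of_isLowerTriangular]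
  · simp [toepL, hcoef_zero hR ht]
  · intro i j hij
    have : i < j := hij
    rw [Matrix.of_apply, toepL, hcoef_of_neg (by omega)]

theorem det_toepU (hR : 1 < R) (ht : RSummable R t) (N : ℕ) :
    (Matrix.of fun i j : Fin N => toepU t i j).det = 1 := by
  rw [← Matrix.det_transpose]
  exact det_toepL hR ht N

theorem det_of_conj (hR : 1 < R) (ht : RSummable R t) (ht' : RSummable R t') (F : ℕ → ℕ → ℂ)
    (N : ℕ) : (Matrix.of fun i j : Fin N => infMul (toepL t) (infMul F (toepU t')) i j).det =
      (Matrix.of fun i j : Fin N => F i j).det := by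
  rw [of_infMul_left_toepL, of_infMul_right_toepU, Matrix.det_mul, Matrix.det_mul,
    det_toepL hR ht, det_toepU hR ht', one_mul, mul_one]

theorem tendsto_det_of_conj (hR : 1 < R) (ht : RSummable R t) (ht' : RSummable R t')
    {F : ℕ → ℕ → ℂ}
    (hF : IsEntrySummable (infMul (toepL t) (infMul F (toepU t')) -
      fun i j => if i = j then 1 else 0)) :
    Tendsto (fun N : ℕ => (Matrix.of fun i j : Fin N => F i j).det) atTop
      (𝓝 (fredDet (infMul (toepL t) (infMul F (toepU t')) -
        fun i j => if i = j then 1 else 0))) := by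
  refine (tendsto_det_one_add hF).congr fun N => ?_
  rw [← det_of_conj hR ht ht']
  congr 1
  ext i j
  simp [Matrix.one_apply, Fin.ext_iff]

end Corner

section Schur

variable {R : ℝ} {t t' : ℕ → ℂ}

theorem Partition'.part_len (lam : Partition') : lam.part lam.len = 0 := by
  obtain ⟨N, hN⟩ := lam.ev_zero
  exact Nat.sInf_mem (s := {N | lam.part N = 0}) ⟨N, hN N le_rfl⟩

theorem Partition'.part_eq_zero_iff (lam : Partition') {N : ℕ} :
    lam.part N = 0 ↔ lam.len ≤ N :=
  ⟨fun h => Nat.sInf_le h, fun h => Nat.eq_zero_of_le_zero (lam.part_len ▸ lam.antitone h)⟩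

/-- The Jacobi–Trudi determinant does not depend on its size. -/
theorem det_jacobiTrudi (hR : 1 < R) (ht : RSummable R t) (lam : Partition') {N : ℕ}
    (hN : lam.part N = 0) :
    (Matrix.of fun i j : Fin N => hcoef t ((lam.part i : ℤ) + (j : ℤ) - (i : ℤ))).det =
      schurPoly t lam := by
  rw [lam.part_eq_zero_iff] at hN
  induction N, hN using Nat.le_induction with
  | base => rfl
  | succ N hN ih =>
    rw [← ih, Matrix.det_succ_row _ (Fin.last N), Finset.sum_eq_single (Fin.last N)]
    · have h0 : lam.part N = 0 := lam.part_eq_zero_iff.2 hN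
      have h1 : (-1 : ℂ) ^ ((Fin.last N : ℕ) + (Fin.last N : ℕ)) = 1 := by
        rw [← two_mul, pow_mul]
        simp
      rw [h1, one_mul, Matrix.of_apply, Fin.val_last, h0]
      simp only [Nat.cast_zero, zero_add, sub_self, hcoef_zero hR ht, one_mul]
      congr 1
      ext i j
      simp
    · intro j _ hj
      have h0 : lam.part N = 0 := lam.part_eq_zero_iff.2 hN
      have hj' : (j : ℕ) < N := by
        have := j.is_lt
        have : (j : ℕ) ≠ N := fun h => hj (Fin.ext h)
        omega
      rw [Matrix.of_apply, Fin.val_last, h0, hcoef_of_neg (by simp; omega)]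
      simp
    · simp

/-- The first `N` points of `S0 lam`. -/
def Partition'.frame (lam : Partition') (N : ℕ) : {q : Fin N → ℤᵒᵈ // StrictMono q} :=
  ⟨fun i => OrderDual.toDual ((lam.part i : ℤ) - (i + 1)), fun i j hij => by
    have := lam.antitone (show (i : ℕ) ≤ j from hij.le)
    have : (i : ℕ) < j := hij
    refine OrderDual.toDual_lt_toDual.2 ?_
    omega⟩

theorem Partition'.frame_injective (N : ℕ) :
    Function.Injective fun lam : {lam : Partition' | lam.part N = 0} => lam.1.frame N := by
  rintro ⟨⟨p, hp, hp'⟩, h⟩ ⟨⟨q, hq, hq'⟩, h'⟩ heq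
  simp only [Set.mem_ofPred_eq] at h h'
  have : p = q := by
    ext i
    by_cases hi : i < N
    · have := congrFun (congrArg Subtype.val heq) ⟨i, hi⟩
      have : (p i : ℤ) - (i + 1) = q i - (i + 1) := this
      omega
    · have h1 := hp (not_lt.1 hi)
      have h2 := hq (not_lt.1 hi)
      omega
  subst this
  rfl

theorem Partition'.exists_frame_eq {N : ℕ} (q : {q : Fin N → ℤᵒᵈ // StrictMono q})
    (hq : ∀ i, -(N : ℤ) ≤ OrderDual.ofDual (q.1 i)) :
    ∃ lam : {lam : Partition' | lam.part N = 0}, lam.1.frame N = q := by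
  have hmono : ∀ i j : Fin N, i ≤ j →
      OrderDual.ofDual (q.1 j) + (j + 1) ≤ OrderDual.ofDual (q.1 i) + (i + 1) := by
    have key : ∀ k i : ℕ, ∀ h : i + k < N,
        OrderDual.ofDual (q.1 ⟨i + k, h⟩) + k ≤ OrderDual.ofDual (q.1 ⟨i, by omega⟩) := by
      intro k i h
      induction k with
      | zero => simp
      | succ k ih =>
        have h1 := ih (by omega)
        have h2 : OrderDual.ofDual (q.1 ⟨i + (k + 1), h⟩) <
            OrderDual.ofDual (q.1 ⟨i + k, by omega⟩) :=
          OrderDual.ofDual_lt_ofDual.2 (q.2 (Fin.mk_lt_mk.2 (by omega)))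
        push_cast
        omega
    rintro ⟨i, hi⟩ ⟨j, hj⟩ hij
    obtain ⟨k, rfl⟩ := Nat.exists_eq_add_of_le (Fin.mk_le_mk.1 hij)
    have := key k i hj
    push_cast
    omega
  refine ⟨⟨⟨fun i => if h : i < N then (OrderDual.ofDual (q.1 ⟨i, h⟩) + (i + 1)).toNat else 0,
    fun i j hij => ?_, N, fun i hi => dif_neg (not_lt.2 hi)⟩, dif_neg (lt_irrefl N)⟩, ?_⟩
  · dsimp only
    split_ifs with h1 h2
    · exact Int.toNat_le_toNat (hmono ⟨i, h2⟩ ⟨j, h1⟩ hij)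
    · omega
    · exact Nat.zero_le _
    · exact le_rfl
  · refine Subtype.ext (funext fun i => ?_)
    have h1 : 0 ≤ OrderDual.ofDual (q.1 i) + ((i : ℕ) + 1) := by
      have hi := i.2
      have := hmono i ⟨N - 1, by omega⟩ (Fin.le_def.2 (Nat.le_sub_one_of_lt hi))
      have h2 := hq ⟨N - 1, by omega⟩
      simp only at this
      omega
    change OrderDual.toDual (((if h : (i : ℕ) < N then
      (OrderDual.ofDual (q.1 ⟨i, h⟩) + ((i : ℕ) + 1)).toNat else 0 : ℕ) : ℤ) - (i + 1)) = q.1 i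
    rw [dif_pos i.2, Int.toNat_of_nonneg h1, add_sub_cancel_right]
    rfl

theorem det_weightedGram (hR : 1 < R) (ht : RSummable R t) (ht' : RSummable R t') {f : ℤ → ℂ}
    (hf : ∀ s, ‖f s‖ ≤ 1) (N : ℕ) :
    (Matrix.of fun i j : Fin N => weightedGram f t t' i j).det =
      ∑' lam : Partition', {lam : Partition' | lam.part N = 0}.indicator
        (fun lam => schurPoly t lam * schurPoly t' lam *
          ∏ i ∈ Finset.range N, f ((lam.part i : ℤ) - (i + 1))) lam := by
  have h := det_of_tsum_mul (α := ℤᵒᵈ) (fun (i : Fin N) s => f s.ofDual * hankZ t i s.ofDual)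
    (fun (i : Fin N) s => hankZ t' i s.ofDual) fun i j => by
      have h1 := summable_hcoef_mul_hcoef hR ht ht' (i + 1) (j + 1)
      refine Summable.of_nonneg_of_le (fun _ => norm_nonneg _) (fun s => ?_) h1.norm
      rw [mul_assoc, norm_mul]
      refine (mul_le_of_le_one_left (norm_nonneg _) (hf _)).trans_eq ?_
      simp only [hankZ, add_assoc]
      rfl
  have hdet : ∀ (t : ℕ → ℂ), RSummable R t → ∀ lam : {lam : Partition' | lam.part N = 0},
      (Matrix.of fun i j : Fin N => hankZ t i ((lam.1.frame N).1 j).ofDual).det =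
        schurPoly t lam.1 := by
    intro t ht lam
    rw [← det_jacobiTrudi hR ht lam.1 lam.2, ← Matrix.det_transpose]
    congr 1
    ext i j
    change hcoef t ((lam.1.part i : ℤ) - (i + 1) + j + 1) = _
    rw [Matrix.of_apply]
    congr 1
    ring
  refine Eq.trans h ?_
  rw [← (Partition'.frame_injective N).tsum_eq, ← tsum_subtype]
  · refine tsum_congr fun lam => ?_
    have h2 := Matrix.det_mul_row (fun j : Fin N => f ((lam.1.frame N).1 j).ofDual)
      (Matrix.of fun i j : Fin N => hankZ t i ((lam.1.frame N).1 j).ofDual)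
    rw [hdet t ht lam] at h2
    rw [hdet t' ht' lam]
    refine (congrArg (· * _) h2).trans ?_
    rw [Finset.prod_range]
    change (∏ i : Fin N, f ((lam.1.part i : ℤ) - (i + 1))) * _ * _ = _
    ring
  · intro q hq
    rw [Function.mem_support] at hq
    by_contra hq'
    have : ∃ i, OrderDual.ofDual (q.1 i) < -(N : ℤ) := by
      by_contra! hcon
      obtain ⟨lam, hlam⟩ := Partition'.exists_frame_eq q hcon
      exact hq' ⟨lam, hlam⟩
    obtain ⟨j, hj⟩ := this
    refine hq ?_
    rw [Matrix.det_eq_zero_of_column_eq_zero (A := Matrix.of fun i j : Fin N =>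
      hankZ t' i (q.1 j).ofDual) j, mul_zero]
    intro i
    have := i.2
    rw [Matrix.of_apply, hankZ, hcoef_of_neg (by omega)]

theorem hasProd_multFunc {σ : ℤ → ℝ} (hσ : Summable fun k : {k : ℤ // k < 0} => σ k) (n : ℤ)
    (lam : Partition') :
    HasProd (fun i : ℕ => 1 - σ ((lam.part i : ℤ) - (i + 1) - n)) (multFunc σ n lam) := by
  have h : Summable fun i : ℕ => ‖-σ ((lam.part i : ℤ) - (i + 1) - n)‖ := by
    obtain ⟨N, hN⟩ := lam.ev_zero
    rw [← summable_nat_add_iff N]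
    refine ((summable_nat_add_iff N).2 (summable_norm_neg_half hσ n)).congr fun m => ?_
    rw [Complex.norm_real, norm_neg, hN _ (Nat.le_add_left N m), Nat.cast_zero, zero_sub]
  have h' := (multipliable_one_add_of_summable h).hasProd
  simp only [← sub_eq_add_neg] at h'
  exact h'

theorem tendsto_det_weightedGram (hR : 1 < R) (ht : RSummable R t) (ht' : RSummable R t')
    {σ : ℤ → ℝ} (hσ01 : ∀ k, σ k ∈ Set.Icc (0 : ℝ) 1)
    (hσ : Summable fun k : {k : ℤ // k < 0} => σ k) (n : ℤ)
    (hsum : Summable fun lam : Partition' => ‖schurPoly t lam * schurPoly t' lam‖) :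
    Tendsto (fun N : ℕ => (Matrix.of fun i j : Fin N =>
        weightedGram (fun s => 1 - (σ (s - n) : ℂ)) t t' i j).det) atTop
      (𝓝 (∑' lam : Partition', schurPoly t lam * schurPoly t' lam * (multFunc σ n lam : ℂ))) := by
  have hf : ∀ s, ‖1 - (σ (s - n) : ℂ)‖ ≤ 1 := fun s => by
    obtain ⟨h0, h1⟩ := hσ01 (s - n)
    rw [← Complex.ofReal_one, ← Complex.ofReal_sub, Complex.norm_real, Real.norm_eq_abs, abs_le]
    constructor <;> linarith
  simp only [det_weightedGram hR ht ht' hf]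
  refine tendsto_tsum_of_dominated_convergence hsum (fun lam => ?_)
    (Eventually.of_forall fun N lam => ?_)
  · have h1 : Tendsto (fun N => schurPoly t lam * schurPoly t' lam *
        ∏ i ∈ Finset.range N, (1 - (σ ((lam.part i : ℤ) - (i + 1) - n) : ℂ))) atTop
        (𝓝 (schurPoly t lam * schurPoly t' lam * (multFunc σ n lam : ℂ))) := by
      refine Tendsto.const_mul _ ?_
      have h2 := (Complex.continuous_ofReal.tendsto _).comp
        (hasProd_multFunc hσ n lam).tendsto_prod_nat
      refine h2.congr fun N => ?_
      simp
    refine h1.congr' ?_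
    filter_upwards [eventually_ge_atTop lam.len] with N hN
    rw [Set.indicator_of_mem]
    exact lam.part_eq_zero_iff.2 hN
  · refine (norm_indicator_le_norm_self _ _).trans ?_
    rw [norm_mul, norm_prod]
    exact mul_le_of_le_one_right (norm_nonneg _)
      (Finset.prod_le_one (fun _ _ => norm_nonneg _) fun _ _ => hf _)

end Schur

end SchurExpectation

/-- the Fredholm determinant `τ_n(t,t';σ) = Z_{t,t'} D_n(t,t';σ)` equals
the sum over Young diagrams `∑_λ s_λ(t) s_λ(t') ∏_{x ∈ S_0(λ)} (1 − σ(x−n))`, i.e.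
`Z_{t,t'}` times the expectation under the Schur measure of the multiplicative
functional. -/
theorem tau_eq_schur_expectation (R : ℝ) (hR : 1 < R) (t t' : ℕ → ℂ)
    (ht : RSummable R t) (ht' : RSummable R t')
    (σ : ℤ → ℝ) (hσ01 : ∀ k, σ k ∈ Set.Icc (0:ℝ) 1)
    (hσsum : Summable fun k : {k : ℤ // k < 0} => σ k)
    (n : ℤ)
    (hsum : Summable fun lam : Partition' => ‖schurPoly t lam * schurPoly t' lam‖) :
    Zconst t t' * fredholmSeries (Kker t t' σ) n
      = ∑' lam : Partition',
          schurPoly t lam * schurPoly t' lam * (multFunc σ n lam : ℂ) := by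
  have hw1 : ∀ s : ℤ, ‖(σ (s - n) : ℂ)‖ ≤ 1 := fun s => by
    rw [Complex.norm_real, Real.norm_of_nonneg (hσ01 _).1]
    exact (hσ01 _).2
  have hw := summable_norm_neg_half hσsum n
  have hM := isEntrySummable_weightedGram hR ht ht' hw1 hw
  obtain ⟨hES, hdet⟩ := fredDet_conj_weightedGram hR ht ht' hM
    (weightedGram_one_sub hR ht ht' hw1)
  have hK := fredholmSeries_eq_fredDet (Kker t t' σ) n
    (-infMul (toepU (-t'))
      (infMul (weightedGram (fun s => (σ (s - n) : ℂ)) t t') (toepL (-t))))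
    (fun i j => by
      rw [Kker_eq_infMul hR ht ht' (isEntrySummable_weighted_hankZ hR ht hw1 hw).isSchur]
      rfl)
    (IsEntrySummable.infMul_left (isSchur_toepU hR ht'.neg)
      (hM.infMul_right (isSchur_toepL hR ht.neg))).neg
  rw [hK, ← hdet]
  exact tendsto_nhds_unique (tendsto_det_of_conj hR ht.neg ht'.neg hES)
    (tendsto_det_weightedGram hR ht ht' hσ01 hσsum n hsum)

end
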